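/- arXiv:1106.0124 — 3 statements merged into one kernel-verified Lean document; each statement's English description precedes it below -/
import Mathlib

section
/- Let N ≥ 1, m ≥ 1 and l ≥ 2 be integers, and let G₁,…,G_m ∈ ℂ[x₀,…,x_N] be homogeneous polynomials with G_i of degree d_i ≥ 1. Assume the numerical condition l·(d₁+⋯+d_m) ≤ N(l−1) + m. Then any two points of the common projective zero locus X of G₁,…,G_m are connected inside X by a chain of lines of length at most l; i.e., for any nonzero vectors v, w ∈ ℂ^{N+1} with G_i(v) = G_i(w) = 0 for all i, there exist nonzero vectors v₀, v₁, …, v_l ∈ ℂ^{N+1} with v₀ = v and v_l = w such that G_i(a·v_{k−1} + b·v_k) = 0 for every i = 1,…,m, every k = 1,…,l and all a, b ∈ ℂ. -/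
open Filter Topology in
/-- If `g` vanishes at `x₀` and has surjective differential there, then `g + t f` has zeros near `x₀`
for all small `t`. -/
theorem MvPolynomial.eventually_exists_zero_of_transverse {σ J : Type*} [Fintype σ] [Fintype J]
    [DecidableEq J] (f g : J → MvPolynomial σ ℂ) (x₀ : σ → ℂ) (u : J → σ → ℂ)
    (hu : ∀ i j (s : ℂ), MvPolynomial.eval (x₀ + s • u j) (g i) = if i = j then s else 0)
    {U : Set (σ → ℂ)} (hU : U ∈ 𝓝 x₀) :
    ∀ᶠ t in 𝓝 (0 : ℂ), ∃ x ∈ U, ∀ j,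
      MvPolynomial.eval x (g j) + t * MvPolynomial.eval x (f j) = 0 := by
  have han (p : MvPolynomial σ ℂ) (z : ℂ × (σ → ℂ)) :
      AnalyticAt ℂ (fun y : ℂ × (σ → ℂ) => MvPolynomial.eval y.2 p) z :=
    (AnalyticOnNhd.eval_mvPolynomial p z.2 trivial).comp analyticAt_snd
  let Φ : ℂ × (σ → ℂ) → ℂ × (J → ℂ) := fun y =>
    (y.1, fun j => MvPolynomial.eval y.2 (g j) + y.1 * MvPolynomial.eval y.2 (f j))
  have hΦ : AnalyticAt ℂ Φ (0, x₀) := by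
    refine analyticAt_fst.prod (AnalyticAt.pi fun j => ?_)
    exact (han _ _).add (analyticAt_fst.mul (han _ _))
  have hg₀ (j : J) : MvPolynomial.eval x₀ (g j) = 0 := by simpa using hu j j 0
  have hΦ₀ : Φ (0, x₀) = 0 := by ext <;> simp [Φ, hg₀]
  have hd := hΦ.hasStrictFDerivAt
  have hdir (p : ℂ × (σ → ℂ)) :
      HasDerivAt (fun s : ℂ => Φ ((0, x₀) + s • p)) (fderiv ℂ Φ (0, x₀) p) 0 := by
    have h1 : HasDerivAt (fun s : ℂ => ((0, x₀) : ℂ × (σ → ℂ)) + s • p) p 0 := by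
      simpa using ((hasDerivAt_id (0 : ℂ)).smul_const p).const_add ((0, x₀) : ℂ × (σ → ℂ))
    have h2 : HasFDerivAt Φ (fderiv ℂ Φ (0, x₀)) (((0, x₀) : ℂ × (σ → ℂ)) + (0 : ℂ) • p) := by
      simpa using hd.hasFDerivAt
    exact h2.comp_hasDerivAt (0 : ℂ) h1
  have hdu (j : J) : fderiv ℂ Φ (0, x₀) (0, u j) = (0, Pi.single j 1) := by
    refine (hdir (0, u j)).unique ?_
    have : (fun s : ℂ => Φ ((0, x₀) + s • (0, u j))) =
        fun s : ℂ => s • ((0, Pi.single j 1) : ℂ × (J → ℂ)) := by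
      funext s
      ext i
      · simp [Φ]
      · simp [Φ, hu, Pi.single_apply]
    rw [this]
    simpa using (hasDerivAt_id (0 : ℂ)).smul_const ((0, Pi.single j 1) : ℂ × (J → ℂ))
  have hd1 (p : ℂ × (σ → ℂ)) : (fderiv ℂ Φ (0, x₀) p).1 = p.1 := by
    have h : HasDerivAt (fun s : ℂ => (Φ ((0, x₀) + s • p)).1) p.1 0 := by
      simpa [Φ] using (hasDerivAt_id (0 : ℂ)).mul_const p.1
    exact (hasFDerivAt_fst.comp_hasDerivAt (0 : ℂ) (hdir p)).unique h
  have hsurj : (fderiv ℂ Φ (0, x₀)).range = ⊤ := by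
    refine LinearMap.range_eq_top.2 fun z => ?_
    set c : J → ℂ := z.2 - z.1 • (fderiv ℂ Φ (0, x₀) (1, 0)).2 with hc
    refine ⟨z.1 • (1, 0) + ∑ j, c j • (0, u j), ?_⟩
    have hz : fderiv ℂ Φ (0, x₀) (z.1 • (1, 0) + ∑ j, c j • (0, u j)) =
        z.1 • fderiv ℂ Φ (0, x₀) (1, 0) + ∑ j, c j • (0, Pi.single j 1) := by
      simp only [map_add, map_smul, map_sum, hdu]
    refine hz.trans ?_
    have hsum : ∑ j, c j • ((0, Pi.single j 1) : ℂ × (J → ℂ)) = (0, c) := by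
      ext i
      · simp [Prod.fst_sum]
      · simp [Prod.snd_sum, Pi.single_apply]
    rw [hsum]
    ext i
    · simp [hd1]
    · simp [hc]
  have hmap := hd.map_nhds_eq_of_surj hsurj
  rw [hΦ₀] at hmap
  have hmem : Φ '' (Set.univ ×ˢ U) ∈ 𝓝 (0 : ℂ × (J → ℂ)) := by
    rw [← hmap]
    exact image_mem_map (prod_mem_nhds univ_mem hU)
  have hcont : Tendsto (fun t : ℂ => ((t, 0) : ℂ × (J → ℂ))) (𝓝 0) (𝓝 0) :=
    (Continuous.prodMk_left (0 : J → ℂ)).tendsto' 0 0 rfl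
  filter_upwards [hcont hmem] with t ht
  obtain ⟨⟨t', x⟩, ⟨-, hx⟩, h⟩ := ht
  obtain ⟨h₁, h₂⟩ := Prod.mk.inj h
  obtain rfl : t' = t := h₁
  exact ⟨x, hx, fun j => congrFun h₂ j⟩

theorem MvPolynomial.weightedHomogeneousComponent_mul_right {σ R M : Type*} [CommSemiring R]
    [AddCancelCommMonoid M] {w : σ → M} {b δ : M} (h f : MvPolynomial σ R)
    (hf : f.IsWeightedHomogeneous w δ) :
    weightedHomogeneousComponent w (b + δ) (h * f) = weightedHomogeneousComponent w b h * f := by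
  classical
  ext d
  rw [coeff_weightedHomogeneousComponent, coeff_mul, coeff_mul]
  trans ∑ e ∈ Finset.HasAntidiagonal.antidiagonal d,
    if Finsupp.weight w d = b + δ then coeff e.1 h * coeff e.2 f else 0
  · split_ifs <;> simp
  refine Finset.sum_congr rfl fun e he => ?_
  rw [coeff_weightedHomogeneousComponent, ← Finset.HasAntidiagonal.mem_antidiagonal.1 he, map_add]
  by_cases hc : coeff e.2 f = 0
  · simp [hc]
  · simp [hf hc]

/-- The weight on variables indexed by blocks for which the weighted homogeneous polynomials are
the multihomogeneous ones. -/
def blockWeight {K ι : Type*} [DecidableEq K] (p : K × ι) : K → ℕ := Pi.single p.1 1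

theorem weight_blockWeight {K ι : Type*} [DecidableEq K] [Fintype K] [Fintype ι]
    (e : K × ι →₀ ℕ) (k : K) : Finsupp.weight blockWeight e k = ∑ i, e (k, i) := by
  rw [Finsupp.weight_apply, Finsupp.sum_fintype _ _ (by simp), Fintype.sum_prod_type]
  simp [blockWeight, Finset.sum_apply, Pi.single_apply]

theorem finite_weight_blockWeight_eq {K ι : Type*} [DecidableEq K] [Fintype K] [Fintype ι]
    (a : K → ℕ) : {e : K × ι →₀ ℕ | Finsupp.weight blockWeight e = a}.Finite := by
  refine (Finsupp.finite_of_degree_le (∑ k, a k)).subset fun e he => ?_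
  have he : Finsupp.weight blockWeight e = a := he
  simp [Finsupp.degree_eq_sum, Fintype.sum_prod_type, ← he, weight_blockWeight]

open MvPolynomial in
/-- If a multihomogeneous system has no zero all of whose blocks are nonzero, its ideal contains
every monomial of some large multidegree. -/
theorem exists_multidegree_monomial_mem_span {K J ι : Type*} [DecidableEq K] [Fintype K]
    [Fintype ι] (f : J → MvPolynomial (K × ι) ℂ)
    (hf : ∀ x : K × ι → ℂ, (∀ j, eval x (f j) = 0) → ∃ k, ∀ i, x (k, i) = 0) (b : K → ℕ) :
    ∃ a : K → ℕ, b ≤ a ∧ ∀ e : K × ι →₀ ℕ, Finsupp.weight blockWeight e = a →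
      monomial e (1 : ℂ) ∈ Ideal.span (Set.range f) := by
  classical
  have hrad (c : K → ι) : ∏ k, X (k, c k) ∈ (Ideal.span (Set.range f)).radical := by
    rw [← vanishingIdeal_zeroLocus_eq_radical (K := ℂ), mem_vanishingIdeal_iff]
    intro x hx
    rw [zeroLocus_span] at hx
    obtain ⟨k, hk⟩ := hf x fun j => by simpa [aeval_eq_eval] using hx (f j) ⟨j, rfl⟩
    simp only [map_prod, aeval_X]
    exact Finset.prod_eq_zero (Finset.mem_univ k) (hk _)
  choose A hA using hrad
  set B := ∑ c, A c
  have hB (c : K → ι) : (∏ k, X (k, c k)) ^ B ∈ Ideal.span (Set.range f) :=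
    Ideal.pow_mem_of_pow_mem _ (hA c)
      (Finset.single_le_sum (fun _ _ => zero_le) (Finset.mem_univ c))
  refine ⟨fun k => Fintype.card ι * B + b k + 1, fun k => by dsimp only; omega, fun e he => ?_⟩
  have hc (k : K) : ∃ i, B ≤ e (k, i) := by
    by_contra! h
    have h1 := congrFun he k
    rw [weight_blockWeight] at h1
    have h2 := Finset.sum_le_card_nsmul Finset.univ (fun i => e (k, i)) B fun i _ => (h i).le
    simp only [Finset.card_univ, smul_eq_mul] at h2
    omega
  choose c hc using hc
  have hmon : (∏ k, X (k, c k)) ^ B =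
      monomial (∑ k, Finsupp.single (k, c k) B) (1 : ℂ) := by
    simp [monomial_sum_one, X_pow_eq_monomial, ← Finset.prod_pow]
  have hle : ∑ k, Finsupp.single (k, c k) B ≤ e := by
    rintro ⟨k, i⟩
    by_cases h : i = c k
    · subst h
      simp only [Finsupp.finsetSum_apply, Finsupp.single_apply]
      rw [Finset.sum_eq_single k] <;> simp +contextual [hc]
    · simp only [Finsupp.finsetSum_apply, Finsupp.single_apply]
      rw [Finset.sum_eq_zero]
      · simp
      · grind
  rw [← tsub_add_cancel_of_le hle, ← one_mul (1 : ℂ), ← monomial_mul, ← hmon]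
  exact Ideal.mul_mem_left _ _ (hB c)

open MvPolynomial in
/-- If the ideal of the homogeneous system `f` contains all monomials of weight `a`, then, `g` having
the same degrees as `f`, the system `g + t f` has a zero at which some monomial of weight `a` does
not vanish for only finitely many `t`: the values of these monomials at such a zero form an
eigenvector, with eigenvalue `-t`, of a fixed matrix. -/
theorem finite_setOf_exists_zero_pencil {σ J M : Type*} [Fintype J]
    [AddCancelCommMonoid M] (w : σ → M) (f g : J → MvPolynomial σ ℂ) (δ b : J → M) (a : M)
    (hab : ∀ j, b j + δ j = a)
    (hf : ∀ j, (f j).IsWeightedHomogeneous w (δ j)) (hg : ∀ j, (g j).IsWeightedHomogeneous w (δ j))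
    (hfin : {e : σ →₀ ℕ | Finsupp.weight w e = a}.Finite)
    (hmem : ∀ e : σ →₀ ℕ, Finsupp.weight w e = a →
      monomial e (1 : ℂ) ∈ Ideal.span (Set.range f)) :
    {t : ℂ | ∃ x : σ → ℂ, (∀ j, eval x (g j) + t * eval x (f j) = 0) ∧
      ∃ e, Finsupp.weight w e = a ∧ eval x (monomial e (1 : ℂ)) ≠ 0}.Finite := by
  classical
  have hrep (e : {e : σ →₀ ℕ | Finsupp.weight w e = a}) : ∃ h : J → MvPolynomial σ ℂ,
      (∀ j, (h j).IsWeightedHomogeneous w (b j)) ∧ ∑ j, h j * f j = monomial e.1 1 := by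
    obtain ⟨h, hh⟩ := Ideal.mem_span_range_iff_exists_fun.1 (hmem e e.2)
    refine ⟨fun j => weightedHomogeneousComponent w (b j) (h j), fun j =>
      weightedHomogeneousComponent_isWeightedHomogeneous _ _, ?_⟩
    have := congrArg (weightedHomogeneousComponent w a) hh
    rw [(isWeightedHomogeneous_monomial w e.1 1 e.2).weightedHomogeneousComponent_same,
      map_sum] at this
    rw [← this]
    refine Finset.sum_congr rfl fun j _ => ?_
    rw [← hab j, weightedHomogeneousComponent_mul_right _ _ (hf j)]
  choose h hhom hsum using hrep
  have := hfin.fintype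
  let B : Matrix {e : σ →₀ ℕ | Finsupp.weight w e = a} {e : σ →₀ ℕ | Finsupp.weight w e = a} ℂ :=
    fun e e' => coeff e'.1 (∑ j, h e j * g j)
  have key (p : MvPolynomial σ ℂ) (hp : p.IsWeightedHomogeneous w a) (x : σ → ℂ) :
      ∑ e : {e : σ →₀ ℕ | Finsupp.weight w e = a}, coeff e.1 p * eval x (monomial e.1 1) =
        eval x p := by
    conv_rhs => rw [p.as_sum, map_sum]
    rw [← Finset.sum_subtype hfin.toFinset (by simp)
      (fun e => coeff e p * eval x (monomial e 1))]
    refine (Finset.sum_subset (s₁ := p.support) ?_ ?_).symm.trans ?_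
    · intro e he
      simpa using hp (mem_support_iff.1 he)
    · intro e _ he
      simp [notMem_support_iff.1 he]
    · refine Finset.sum_congr rfl fun e _ => ?_
      simp [eval_monomial]
  refine ((Module.End.finite_hasEigenvalue (Matrix.toLin' B)).preimage
    neg_injective.injOn).subset ?_
  rintro t ⟨x, hx, e, he, hne⟩
  refine Module.End.hasEigenvalue_of_hasEigenvector
    (x := fun e => eval x (monomial e.1 1)) ⟨?_, fun h0 => hne (congrFun h0 ⟨e, he⟩)⟩
  rw [Module.End.mem_eigenspace_iff]
  funext e
  rw [Matrix.toLin'_apply]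
  refine (key _ ?_ x).trans ?_
  · refine IsWeightedHomogeneous.sum _ _ _ fun j _ => ?_
    rw [← hab j]
    exact (hhom e j).mul (hg j)
  · have hgx (j : J) : eval x (g j) = -t * eval x (f j) := by linear_combination hx j
    simp only [Pi.smul_apply, ← hsum e, map_sum, map_mul, hgx, smul_eq_mul, Finset.mul_sum]
    exact Finset.sum_congr rfl fun j _ => by ring

open MvPolynomial Filter Topology in
/-- A multihomogeneous system on a product of copies of `ℙ^n` has a zero as soon as its equations
can be injectively assigned to hyperplane classes occurring in their multidegrees, each class being
available `n` times. -/
theorem exists_multiprojective_zero {K J : Type*} [DecidableEq K] [Fintype K] [Fintype J] {n : ℕ}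
    (f : J → MvPolynomial (K × Fin (n + 1)) ℂ) (δ : J → K → ℕ)
    (hf : ∀ j, (f j).IsWeightedHomogeneous blockWeight (δ j))
    (τ : J → K × Fin n) (hτ : Function.Injective τ) (hδ : ∀ j, δ j (τ j).1 ≠ 0) :
    ∃ x : K × Fin (n + 1) → ℂ, (∀ j, eval x (f j) = 0) ∧ ∀ k, ∃ i, x (k, i) ≠ 0 := by
  classical
  by_contra! hcon
  obtain ⟨a, hδa, ha⟩ := exists_multidegree_monomial_mem_span f hcon (∑ j, δ j)
  let g : J → MvPolynomial (K × Fin (n + 1)) ℂ := fun j =>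
    X ((τ j).1, (τ j).2.succ) * ∏ k, X (k, 0) ^ (δ j - Pi.single (τ j).1 1 : K → ℕ) k
  have hle (j : J) : Pi.single (τ j).1 1 ≤ δ j := by
    intro k
    by_cases h : k = (τ j).1
    · subst h
      simpa using Nat.one_le_iff_ne_zero.2 (hδ j)
    · simp [h]
  have hg (j : J) : (g j).IsWeightedHomogeneous blockWeight (δ j) := by
    have h1 : (∏ k, X (k, 0) ^ (δ j - Pi.single (τ j).1 1 : K → ℕ) k :
        MvPolynomial (K × Fin (n + 1)) ℂ).IsWeightedHomogeneous blockWeight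
        (∑ k, (δ j - Pi.single (τ j).1 1 : K → ℕ) k • blockWeight (k, (0 : Fin (n + 1)))) :=
      IsWeightedHomogeneous.prod _ _ _ fun k _ => (isWeightedHomogeneous_X ℂ _ _).pow _
    have h2 := (isWeightedHomogeneous_X ℂ blockWeight ((τ j).1, (τ j).2.succ)).mul h1
    convert h2 using 1
    have h3 (c : K → ℕ) : ∑ k, c k • blockWeight (k, (0 : Fin (n + 1))) = c := by
      ext i
      simp [blockWeight, Finset.sum_apply, Pi.single_apply]
    rw [h3]
    exact (add_tsub_cancel_of_le (hle j)).symm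
  let x₀ : K × Fin (n + 1) → ℂ := fun p => if p.2 = 0 then 1 else 0
  let u : J → K × Fin (n + 1) → ℂ := fun j => Pi.single ((τ j).1, (τ j).2.succ) 1
  have hu (i j : J) (s : ℂ) : eval (x₀ + s • u j) (g i) = if i = j then s else 0 := by
    simp [g, x₀, u, Pi.single_apply, ← Prod.ext_iff, hτ.eq_iff, Fin.succ_ne_zero,
      (Fin.succ_ne_zero _).symm]
  have hU : {x : K × Fin (n + 1) → ℂ | ∀ k, x (k, 0) ≠ 0} ∈ 𝓝 x₀ := by
    refine IsOpen.mem_nhds ?_ (by simp [x₀])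
    simp only [Set.ofPred_forall]
    exact isOpen_iInter_of_finite fun k => isOpen_ne_fun (continuous_apply _) continuous_const
  have hsmall := eventually_exists_zero_of_transverse f g x₀ u hu hU
  refine (infinite_of_mem_nhds (0 : ℂ) hsmall) ((finite_setOf_exists_zero_pencil blockWeight f g δ
    (fun j => a - δ j) a (fun j => tsub_add_cancel_of_le ?_) hf hg (finite_weight_blockWeight_eq a)
    ha).subset ?_)
  · exact (Finset.single_le_sum (fun _ _ => zero_le) (Finset.mem_univ j)).trans hδa
  · rintro t ⟨x, hx, hxt⟩
    refine ⟨x, hxt, ∑ k, Finsupp.single (k, 0) (a k), ?_, ?_⟩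
    · ext k
      rw [weight_blockWeight, Finset.sum_eq_single 0] <;>
        simp +contextual [Finsupp.finsetSum_apply, Finsupp.single_apply, eq_comm]
    · simp [monomial_sum_one, eval_monomial, Finset.prod_eq_zero_iff, hx _]

theorem exists_injective_slot_assignment {N L D m : ℕ} (hL : 1 ≤ L)
    (h : (L + 1) * (D + m) ≤ N * L + m) :
    ∃ τ : (Fin (L + 1) × Fin D) ⊕ (Fin L × Fin m) → Fin L × Fin N, Function.Injective τ ∧
      (∀ k p, ((τ (.inl (k, p))).1 : ℕ) = k ∨ ((τ (.inl (k, p))).1 : ℕ) + 1 = k) ∧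
      ∀ k i, (τ (.inr (k, i))).1 = k := by
  have hDm : D + m ≤ N := by
    by_contra! hlt
    nlinarith
  obtain ⟨E, rfl⟩ := Nat.exists_eq_add_of_le hDm
  obtain ⟨s, hs0, hsD, hsL, hs⟩ : ∃ s : ℕ → ℕ, s 0 = 0 ∧ (∀ k, s k ≤ D) ∧ s L = D ∧
      ∀ k < L, s (k + 1) ≤ s k + E := by
    refine ⟨fun k => D - (L - k) * E, ?_, fun k => Nat.sub_le _ _, by simp, fun k hk => ?_⟩
    · simp only [Nat.sub_zero]
      exact Nat.sub_eq_zero_of_le (by nlinarith)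
    · obtain ⟨r, rfl⟩ := Nat.exists_eq_add_of_lt hk
      have h1 : k + r + 1 - (k + 1) = r := by omega
      have h2 : k + r + 1 - k = r + 1 := by omega
      simp only [h1, h2, add_mul, one_mul]
      omega
  have hs0' (k : ℕ) (p : ℕ) (hp : p < s k) : k ≠ 0 := by
    rintro rfl
    omega
  have hsL' (k : ℕ) (hk : k < L + 1) (p : ℕ) (hpD : p < D) (hp : ¬ p < s k) : k < L := by
    rcases Nat.lt_succ_iff_lt_or_eq.1 hk with h | rfl
    · exact h
    · omega
  have hs' (k k' : ℕ) (hk : k < L) (hk' : k' = k + 1) : s k' ≤ s k + E := hk' ▸ hs k hk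
  refine ⟨Sum.elim
    (fun q => if hp : (q.2 : ℕ) < s q.1 then
        (⟨q.1 - 1, by have := hs0' _ _ hp; omega⟩, ⟨D + m + E - 1 - q.2, by omega⟩)
      else (⟨q.1, hsL' _ q.1.2 _ q.2.2 hp⟩, ⟨q.2 - s q.1, by omega⟩))
    (fun q => (q.1, ⟨D + q.2 - s q.1, by omega⟩)), ?_, ?_, ?_⟩
  · rintro (⟨⟨k, hk⟩, ⟨p, hp⟩⟩ | ⟨⟨k, hk⟩, ⟨p, hp⟩⟩)
      (⟨⟨k', hk'⟩, ⟨p', hp'⟩⟩ | ⟨⟨k', hk'⟩, ⟨p', hp'⟩⟩)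
    all_goals
      have a1 := hs0' k p
      have a2 := hs0' k' p'
      have a5 := hs' k k'
      have a6 := hs' k' k
      have a7 := hsD k
      have a8 := hsD k'
      have a9 : k = k' → s k = s k' := congrArg s
      simp only [Sum.elim_inl, Sum.elim_inr]
      try split_ifs
      all_goals simp only [Prod.mk.injEq, Fin.mk.injEq, Sum.inl.injEq, Sum.inr.injEq,
        imp_false]
      all_goals omega
  · intro k p
    simp only [Sum.elim_inl]
    split_ifs with hp
    · have := hs0' _ _ hp
      right
      dsimp only
      omega
    · exact Or.inl rfl
  · exact fun _ _ => rfl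

open MvPolynomial in
/-- The restriction of `G` to the line `p + T q`, as a polynomial in `T`. -/
noncomputable def MvPolynomial.linePolynomial {ι A : Type*} [CommRing A] [Algebra ℂ A]
    (p q : ι → A) (G : MvPolynomial ι ℂ) : Polynomial A :=
  aeval (fun n => Polynomial.C (p n) + Polynomial.X * Polynomial.C (q n)) G

/-- `F` has degree at most `d` in `T`, and the coefficients of `F` are those of a form of degree `d`
evaluated on a line spanned by points of multidegrees `α` and `β`. -/
def IsBihomogeneousOfDegree {σ M : Type*} [AddCommMonoid M] (w : σ → M) (α β : M) (d : ℕ)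
    (F : Polynomial (MvPolynomial σ ℂ)) : Prop :=
  F.natDegree ≤ d ∧ ∀ i j, i + j = d → (F.coeff j).IsWeightedHomogeneous w (i • α + j • β)

namespace IsBihomogeneousOfDegree

variable {σ M : Type*} [AddCommMonoid M] {w : σ → M} {α β : M}

theorem one : IsBihomogeneousOfDegree w α β 0 1 := by
  refine ⟨by simp, fun i j hij => ?_⟩
  obtain ⟨rfl, rfl⟩ : i = 0 ∧ j = 0 := by omega
  simpa using MvPolynomial.isWeightedHomogeneous_one ℂ w

theorem mul {d e : ℕ} {F H : Polynomial (MvPolynomial σ ℂ)}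
    (hF : IsBihomogeneousOfDegree w α β d F) (hH : IsBihomogeneousOfDegree w α β e H) :
    IsBihomogeneousOfDegree w α β (d + e) (F * H) := by
  refine ⟨Polynomial.natDegree_mul_le_of_le hF.1 hH.1, fun i j hij => ?_⟩
  rw [Polynomial.coeff_mul]
  refine MvPolynomial.IsWeightedHomogeneous.sum _ _ _ fun x hx => ?_
  rw [Finset.HasAntidiagonal.mem_antidiagonal] at hx
  by_cases h1 : x.1 ≤ d
  · by_cases h2 : x.2 ≤ e
    · convert (hF.2 (d - x.1) x.1 (by omega)).mul (hH.2 (e - x.2) x.2 (by omega)) using 1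
      rw [show i = (d - x.1) + (e - x.2) by omega, ← hx]
      simp only [add_smul]
      abel
    · rw [H.coeff_eq_zero_of_natDegree_lt (by have := hH.1; omega), mul_zero]
      exact MvPolynomial.isWeightedHomogeneous_zero ..
  · rw [F.coeff_eq_zero_of_natDegree_lt (by have := hF.1; omega), zero_mul]
    exact MvPolynomial.isWeightedHomogeneous_zero ..

theorem pow {d : ℕ} {F : Polynomial (MvPolynomial σ ℂ)}
    (hF : IsBihomogeneousOfDegree w α β d F) (n : ℕ) :
    IsBihomogeneousOfDegree w α β (n * d) (F ^ n) := by
  induction n with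
  | zero => simpa using one
  | succ n ih => simpa [pow_succ, add_mul] using ih.mul hF

theorem prod {ι : Type*} (s : Finset ι) {d : ι → ℕ} {F : ι → Polynomial (MvPolynomial σ ℂ)}
    (hF : ∀ i, IsBihomogeneousOfDegree w α β (d i) (F i)) :
    IsBihomogeneousOfDegree w α β (∑ i ∈ s, d i) (∏ i ∈ s, F i) := by
  classical
  induction s using Finset.induction_on with
  | empty => simpa using one
  | insert i s hi ih => simpa [Finset.prod_insert hi, Finset.sum_insert hi] using (hF i).mul ih

theorem C_add_X_mul_C {p q : MvPolynomial σ ℂ} (hp : p.IsWeightedHomogeneous w α)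
    (hq : q.IsWeightedHomogeneous w β) :
    IsBihomogeneousOfDegree w α β 1 (Polynomial.C p + Polynomial.X * Polynomial.C q) := by
  refine ⟨by compute_degree, fun i j hij => ?_⟩
  obtain ⟨rfl, rfl⟩ | ⟨rfl, rfl⟩ : i = 1 ∧ j = 0 ∨ i = 0 ∧ j = 1 := by omega
  · simpa using hp
  · simpa using hq

theorem sum {ι : Type*} (s : Finset ι) {d : ℕ} {F : ι → Polynomial (MvPolynomial σ ℂ)}
    (hF : ∀ i ∈ s, IsBihomogeneousOfDegree w α β d (F i)) :
    IsBihomogeneousOfDegree w α β d (∑ i ∈ s, F i) := by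
  refine ⟨Polynomial.natDegree_sum_le_of_forall_le _ _ fun i hi => (hF i hi).1, fun i j hij => ?_⟩
  rw [Polynomial.finsetSum_coeff]
  exact MvPolynomial.IsWeightedHomogeneous.sum _ _ _ fun k hk => (hF k hk).2 i j hij

theorem linePolynomial {ι : Type*} {d : ℕ} {G : MvPolynomial ι ℂ} (hG : G.IsHomogeneous d)
    {p q : ι → MvPolynomial σ ℂ} (hp : ∀ n, (p n).IsWeightedHomogeneous w α)
    (hq : ∀ n, (q n).IsWeightedHomogeneous w β) :
    IsBihomogeneousOfDegree w α β d (MvPolynomial.linePolynomial p q G) := by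
  rw [MvPolynomial.linePolynomial, MvPolynomial.aeval_def, MvPolynomial.eval₂_eq]
  refine sum _ fun e he => ?_
  have h0 : IsBihomogeneousOfDegree w α β 0
      (algebraMap ℂ (Polynomial (MvPolynomial σ ℂ)) (G.coeff e)) := by
    refine ⟨by simp [Polynomial.algebraMap_apply], fun i j hij => ?_⟩
    obtain ⟨rfl, rfl⟩ : i = 0 ∧ j = 0 := by omega
    simpa [Polynomial.algebraMap_apply] using MvPolynomial.isWeightedHomogeneous_C w _
  have hd : d = 0 + ∑ i ∈ e.support, e i * 1 := by
    simp [← hG.degree_eq_sum_deg_support he]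
  rw [hd]
  exact h0.mul (prod _ fun i => (C_add_X_mul_C (hp i) (hq i)).pow _)

end IsBihomogeneousOfDegree

namespace MvPolynomial

theorem map_linePolynomial {σ ι : Type*} (x : σ → ℂ) (p q : ι → MvPolynomial σ ℂ)
    (G : MvPolynomial ι ℂ) :
    (linePolynomial p q G).map (eval x) =
      linePolynomial (fun n => eval x (p n)) (fun n => eval x (q n)) G := by
  induction G using MvPolynomial.induction_on with
  | C c => simp [linePolynomial, Polynomial.algebraMap_apply]
  | add G H hG hH => simp_all [linePolynomial]
  | mul_X G n hG => simp_all [linePolynomial]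

theorem eval_linePolynomial {ι : Type*} (y z : ι → ℂ) (G : MvPolynomial ι ℂ) (t : ℂ) :
    (linePolynomial y z G).eval t = eval (y + t • z) G := by
  induction G using MvPolynomial.induction_on with
  | C c => simp [linePolynomial]
  | add G H hG hH => simp_all [linePolynomial]
  | mul_X G n hG => simp_all [linePolynomial, mul_comm t]

theorem IsHomogeneous.eval_smul_eq {ι R : Type*} [CommSemiring R] {d : ℕ} {G : MvPolynomial ι R}
    (hG : G.IsHomogeneous d) (a : R) (y : ι → R) : eval (a • y) G = a ^ d * eval y G := by
  rw [eval_eq, eval_eq, Finset.mul_sum]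
  refine Finset.sum_congr rfl fun e he => ?_
  simp only [Pi.smul_apply, smul_eq_mul, mul_pow, Finset.prod_mul_distrib,
    Finset.prod_pow_eq_pow_sum]
  rw [← hG.degree_eq_sum_deg_support he]
  ring

/-- A form of degree `d` vanishing at `y` and `z` vanishes on the line they span if the
intermediate coefficients of its restriction to that line do. -/
theorem IsHomogeneous.eval_line_eq_zero {ι : Type*} {d : ℕ} {G : MvPolynomial ι ℂ}
    (hG : G.IsHomogeneous d) {y z : ι → ℂ} (hy : eval y G = 0) (hz : eval z G = 0)
    (hcoeff : ∀ j, 1 ≤ j → j < d → (linePolynomial y z G).coeff j = 0) (a b : ℂ) :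
    eval (a • y + b • z) G = 0 := by
  set c := (linePolynomial y z G).coeff d
  have hdeg : (linePolynomial y z G).natDegree ≤ d := by
    have h := (IsBihomogeneousOfDegree.linePolynomial (w := fun _ : ι => (0 : ℕ)) (α := 0) (β := 0)
      hG (p := fun n => C (y n)) (q := fun n => C (z n)) (fun n => isWeightedHomogeneous_C _ _)
      fun n => isWeightedHomogeneous_C _ _).1
    have h2 := map_linePolynomial (0 : ι → ℂ) (fun n => C (y n)) (fun n => C (z n)) G
    simp only [eval_C] at h2
    rw [← h2]
    exact Polynomial.natDegree_map_le.trans h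
  have h0 : (linePolynomial y z G).coeff 0 = 0 := by
    rw [Polynomial.coeff_zero_eq_eval_zero, eval_linePolynomial]
    simpa using hy
  have hline : linePolynomial y z G = Polynomial.C c * Polynomial.X ^ d := by
    ext j
    rw [Polynomial.coeff_C_mul_X_pow]
    split_ifs with hj
    · rw [hj]
    · rcases lt_or_gt_of_ne hj with h | h
      · rcases Nat.eq_zero_or_pos j with rfl | hj0
        · exact h0
        · exact hcoeff j hj0 h
      · exact Polynomial.coeff_eq_zero_of_natDegree_lt (by omega)
  have hne (a b : ℂ) (ha : a ≠ 0) : eval (a • y + b • z) G = c * b ^ d := by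
    have h1 : a • y + b • z = a • (y + (b / a) • z) := by
      rw [smul_add, smul_smul, mul_div_cancel₀ _ ha]
    rw [h1, hG.eval_smul_eq, ← eval_linePolynomial, hline]
    simp only [Polynomial.eval_mul, Polynomial.eval_C, Polynomial.eval_pow, Polynomial.eval_X,
      div_pow]
    field_simp
  have hall (a b : ℂ) : eval (a • y + b • z) G = c * b ^ d := by
    have hcont : Continuous fun s : ℂ => eval (s • y + b • z) G :=
      (continuous_eval G).comp (by fun_prop)
    exact congrFun (hcont.ext_on (dense_compl_singleton (0 : ℂ)) continuous_const
      fun s hs => hne s b hs) a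
  have hc : c = 0 := by simpa [hz] using (hall 0 1).symm
  rw [hall, hc, zero_mul]

end MvPolynomial


/-- Marchesi–Massarenti, main theorem: if `X ⊆ ℙ^N` is set-theoretically defined by
homogeneous polynomials `G i` of degree `d i` and `l * ∑ d i ≤ N * (l-1) + m`, then any
two points of `X` are connected inside `X` by a chain of lines of length at most `l`. -/
theorem chain_connected_of_degree_bound
    (N m l : ℕ) (hN : 1 ≤ N) (hm : 1 ≤ m) (hl : 2 ≤ l)
    (d : Fin m → ℕ) (hd : ∀ i, 1 ≤ d i)
    (G : Fin m → MvPolynomial (Fin (N + 1)) ℂ)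
    (hG : ∀ i, (G i).IsHomogeneous (d i))
    (hnum : l * (∑ i, d i) ≤ N * (l - 1) + m)
    (v w : Fin (N + 1) → ℂ) (hv : v ≠ 0) (hw : w ≠ 0)
    (hGv : ∀ i, MvPolynomial.eval v (G i) = 0)
    (hGw : ∀ i, MvPolynomial.eval w (G i) = 0) :
    ∃ vs : Fin (l + 1) → (Fin (N + 1) → ℂ),
      vs 0 = v ∧ vs (Fin.last l) = w ∧ (∀ k, vs k ≠ 0) ∧
      ∀ (i : Fin m) (k : Fin l) (a b : ℂ),
        MvPolynomial.eval (a • vs k.castSucc + b • vs k.succ) (G i) = 0 := by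
  obtain ⟨L, rfl⟩ : ∃ L, l = L + 1 := ⟨l - 1, by omega⟩
  have hL : 1 ≤ L := by omega
  have hsum : ∑ i, d i = ∑ i, (d i - 1) + m := by
    have h : ∑ i, (d i - 1 + 1) = ∑ i, d i :=
      Finset.sum_congr rfl fun i _ => Nat.sub_add_cancel (hd i)
    simpa [Finset.sum_add_distrib] using h.symm
  rw [hsum, Nat.add_sub_cancel] at hnum
  obtain ⟨τ, hτ, hτl, hτr⟩ := exists_injective_slot_assignment hL hnum
  -- The points of the chain: `v`, then `L` points with unknown coordinates, then `w`.
  let P : ℕ → Fin (N + 1) → MvPolynomial (Fin L × Fin (N + 1)) ℂ := fun k n =>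
    if k = 0 then MvPolynomial.C (v n)
    else if h : k - 1 < L then MvPolynomial.X (⟨k - 1, h⟩, n) else MvPolynomial.C (w n)
  let α : ℕ → Fin L → ℕ := fun k b => if k = b + 1 then 1 else 0
  have hP (k : ℕ) (n : Fin (N + 1)) : (P k n).IsWeightedHomogeneous blockWeight (α k) := by
    have hα (h : ∀ b : Fin L, k ≠ b + 1) : α k = 0 := funext fun b => if_neg (h b)
    simp only [P]
    split_ifs with h0 h1
    · rw [hα (by omega)]
      exact MvPolynomial.isWeightedHomogeneous_C _ _
    · have : α k = blockWeight ((⟨k - 1, h1⟩, n) : Fin L × Fin (N + 1)) := by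
        funext b
        simp only [α, blockWeight, Pi.single_apply, Fin.ext_iff]
        exact if_congr (by omega) rfl rfl
      rw [this]
      exact MvPolynomial.isWeightedHomogeneous_X ℂ _ _
    · rw [hα (by omega)]
      exact MvPolynomial.isWeightedHomogeneous_C _ _
  have hline (k : ℕ) (i : Fin m) :=
    IsBihomogeneousOfDegree.linePolynomial (hG i) (hP k) (hP (k + 1))
  obtain ⟨x, hx, hx0⟩ := exists_multiprojective_zero
    (J := (Fin (L + 1) × Σ i, Fin (d i - 1)) ⊕ (Fin L × Fin m))
    (Sum.elim
      (fun q => (MvPolynomial.linePolynomial (P q.1) (P (q.1 + 1)) (G q.2.1)).coeff (q.2.2 + 1))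
      (fun q => (MvPolynomial.linePolynomial (P (q.1 + 1)) (P (q.1 + 1 + 1)) (G q.2)).coeff 0))
    (Sum.elim
      (fun q => (d q.2.1 - (q.2.2 + 1)) • α q.1 + ((q.2.2 : ℕ) + 1) • α (q.1 + 1))
      (fun q => d q.2 • α (q.1 + 1) + 0 • α (q.1 + 1 + 1)))
    (by
      rintro (⟨k, i, j⟩ | ⟨k, i⟩)
      · exact (hline k i).2 _ _ (by dsimp only; omega)
      · exact (hline (k + 1) i).2 _ _ (by dsimp only; omega))
    (τ ∘ Sum.map (Prod.map id finSigmaFinEquiv) id)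
    (hτ.comp (Sum.map_injective.2
      ⟨Function.injective_id.prodMap finSigmaFinEquiv.injective, Function.injective_id⟩))
    (by
      rintro (⟨k, i, j⟩ | ⟨k, i⟩)
      · have := hτl k (finSigmaFinEquiv ⟨i, j⟩)
        simp only [Function.comp_apply, Sum.map_inl, Prod.map_apply, id_eq, Sum.elim_inl,
          Pi.add_apply, Pi.smul_apply, smul_eq_mul, α]
        split_ifs <;> omega
      · have := hd i
        simp only [Function.comp_apply, Sum.map_inr, id_eq, Sum.elim_inr, hτr,
          Pi.add_apply, Pi.smul_apply, smul_eq_mul, α, if_true]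
        omega)
  let Q : ℕ → Fin (N + 1) → ℂ := fun k n => MvPolynomial.eval x (P k n)
  have hcoeff (k k' : ℕ) (i : Fin m) (j : ℕ) :
      (MvPolynomial.linePolynomial (Q k) (Q k') (G i)).coeff j =
        MvPolynomial.eval x ((MvPolynomial.linePolynomial (P k) (P k') (G i)).coeff j) := by
    rw [← MvPolynomial.map_linePolynomial, Polynomial.coeff_map]
  have hQv : Q 0 = v := by
    funext n
    simp [Q, P]
  have hQw : Q (L + 1) = w := by
    funext n
    simp [Q, P]
  have hQne (k : ℕ) : Q k ≠ 0 := by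
    by_cases h0 : k = 0
    · rwa [h0, hQv]
    by_cases h1 : k - 1 < L
    · obtain ⟨n, hn⟩ := hx0 ⟨k - 1, h1⟩
      intro h
      exact hn (by simpa [Q, P, h0, h1] using congrFun h n)
    · have : Q k = w := by
        funext n
        simp [Q, P, h0, h1]
      rwa [this]
  have hQG (k : ℕ) (hk : k ≤ L + 1) (i : Fin m) : MvPolynomial.eval (Q k) (G i) = 0 := by
    rcases Nat.eq_zero_or_pos k with rfl | hk0
    · rw [hQv, hGv]
    rcases hk.eq_or_lt with rfl | hkL
    · rw [hQw, hGw]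
    obtain ⟨b, rfl⟩ : ∃ b, k = b + 1 := ⟨k - 1, by omega⟩
    have h := hx (.inr (⟨b, by omega⟩, i))
    rw [Sum.elim_inr, ← hcoeff, Polynomial.coeff_zero_eq_eval_zero,
      MvPolynomial.eval_linePolynomial] at h
    simpa using h
  refine ⟨fun k => Q k, hQv, hQw, fun k => hQne k, fun i k a b => ?_⟩
  refine (hG i).eval_line_eq_zero (hQG _ (by dsimp; omega) i) (hQG _ (by dsimp; omega) i) ?_ a b
  intro j hj1 hjd
  obtain ⟨j, rfl⟩ : ∃ j', j = j' + 1 := ⟨j - 1, by omega⟩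
  rw [hcoeff]
  simpa using hx (.inl (k, ⟨i, ⟨j, by omega⟩⟩))
end

section
/- Let N ≥ 2 be an integer and let G ∈ ℂ[x₀,…,x_N] be a homogeneous polynomial of degree d with 1 ≤ d ≤ N−1, defining the hypersurface X ⊂ ℙ^N. Then any two points of X are connected inside X by a chain of lines of length at most N−1: for any nonzero v, w ∈ ℂ^{N+1} with G(v) = G(w) = 0, there exist nonzero vectors v₀,…,v_{N−1} ∈ ℂ^{N+1} with v₀ = v, v_{N−1} = w and G(a·v_{k−1} + b·v_k) = 0 for every k = 1,…,N−1 and all a, b ∈ ℂ. -/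
namespace MvPolynomial

open Filter Topology

section Graded

variable {σ R M J : Type*} [CommRing R] [AddCommMonoid M] [PartialOrder M]
  [CanonicallyOrderedAdd M] [IsOrderedCancelAddMonoid M] [Sub M] [OrderedSub M] {w : σ → M}

open scoped Classical in
lemma IsWeightedHomogeneous.weightedHomogeneousComponent_mul {f : MvPolynomial σ R} {D : M}
    (hf : IsWeightedHomogeneous w f D) (g : MvPolynomial σ R) (E : M) :
    weightedHomogeneousComponent w E (g * f) =
      if D ≤ E then weightedHomogeneousComponent w (E - D) g * f else 0 := by
  let _ := weightedGradedAlgebra R w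
  have key := DirectSum.coe_decompose_mul_of_right_mem (weightedHomogeneousSubmodule R w)
    (a := g) E ((mem_weightedHomogeneousSubmodule R w D f).2 hf)
  have h (p : MvPolynomial σ R) (m : M) :
      (DirectSum.decompose (weightedHomogeneousSubmodule R w) p m : MvPolynomial σ R) =
        weightedHomogeneousComponent w m p :=
    weightedDecomposition.decompose'_apply R w p m
  simpa only [h] using key

/-- A homogeneous element of an ideal generated by homogeneous polynomials is a combination of the
generators with homogeneous coefficients of the complementary degrees. -/
lemma IsWeightedHomogeneous.exists_eq_sum_of_mem_span [Fintype J]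
    {f : J → MvPolynomial σ R} {D : J → M} (hf : ∀ j, IsWeightedHomogeneous w (f j) (D j))
    {p : MvPolynomial σ R} {E : M} (hp : IsWeightedHomogeneous w p E)
    (hmem : p ∈ Ideal.span (Set.range f)) :
    ∃ q : J → MvPolynomial σ R, p = ∑ j, q j * f j ∧
      ∀ j (m : MvPolynomial σ R), IsWeightedHomogeneous w m (D j) →
        IsWeightedHomogeneous w (q j * m) E := by
  classical
  obtain ⟨c, hc⟩ := Ideal.mem_span_range_iff_exists_fun.1 hmem
  refine ⟨fun j ↦ if D j ≤ E then weightedHomogeneousComponent w (E - D j) (c j) else 0,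
    ?_, fun j m hm ↦ ?_⟩
  · rw [← hp.weightedHomogeneousComponent_same, ← hc, map_sum]
    refine Finset.sum_congr rfl fun j _ ↦ ?_
    rw [(hf j).weightedHomogeneousComponent_mul]
    split_ifs <;> simp_all
  · dsimp only
    split_ifs with h
    · simpa [tsub_add_cancel_of_le h] using
        (weightedHomogeneousComponent_isWeightedHomogeneous (E - D j) (c j)).mul hm
    · simpa using isWeightedHomogeneous_zero R w E

end Graded

/-- An endomorphism of a finite-dimensional space has only finitely many eigenvalues, also when
the eigenvectors are taken in the dual space. -/
lemma _root_.Module.End.finite_setOf_dual_eigenvector {K V : Type*} [Field K] [AddCommGroup V]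
    [Module K V] [FiniteDimensional K V] (T : Module.End K V) :
    {s : K | ∃ φ : Module.Dual K V, φ ≠ 0 ∧ ∀ p, φ (T p) = s * φ p}.Finite := by
  refine (Module.End.finite_hasEigenvalue (Module.Dual.transpose (R := K) T)).subset ?_
  rintro s ⟨φ, hφ, h⟩
  refine Module.End.hasEigenvalue_of_hasEigenvector (x := φ) ⟨?_, hφ⟩
  rw [Module.End.mem_eigenspace_iff]
  exact LinearMap.ext h

section Blocks

variable {ι κ J K : Type*} [DecidableEq ι]

/-- The weight recording the multidegree with respect to the blocks of variables
`{k} × κ`, `k : ι`. -/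
def blockWeight (ι κ : Type*) [DecidableEq ι] (p : ι × κ) : ι → ℕ := Pi.single p.1 1

lemma weight_blockWeight_apply [Fintype ι] [Fintype κ] (m : ι × κ →₀ ℕ) (k : ι) :
    Finsupp.weight (blockWeight ι κ) m k = ∑ i, m (k, i) := by
  simp [Finsupp.weight_eq_sum, Fintype.sum_prod_type, blockWeight, Pi.single_apply,
    Finset.sum_comm (s := (Finset.univ : Finset ι))]

variable [Field K]

lemma finiteDimensional_weightedHomogeneousSubmodule_blockWeight [Fintype ι] [Fintype κ]
    (E : ι → ℕ) : FiniteDimensional K (weightedHomogeneousSubmodule K (blockWeight ι κ) E) := by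
  have : FiniteDimensional K (homogeneousSubmodule (ι × κ) K (∑ k, E k)) :=
    Module.Finite.iff_fg.2 (homogeneousSubmodule_fg _ _ _)
  refine Submodule.finiteDimensional_of_le (S₂ := homogeneousSubmodule (ι × κ) K (∑ k, E k)) ?_
  intro p hp m hm
  have := hp hm
  rw [Finsupp.weight_eq_sum, Fintype.sum_prod_type, ← this]
  simp [weight_blockWeight_apply]

/-- The Nullstellensatz for multihomogeneous polynomials. -/
lemma exists_mem_span_of_blockWeight [Fintype ι] [Fintype κ] [IsAlgClosed K]
    {f : J → MvPolynomial (ι × κ) K}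
    (hf : ∀ x : ι × κ → K, (∀ j, eval x (f j) = 0) → ∃ k, ∀ i, x (k, i) = 0) :
    ∃ e : ℕ, ∀ p, IsWeightedHomogeneous (blockWeight ι κ) p (fun _ ↦ e) →
      p ∈ Ideal.span (Set.range f) := by
  let B : ι → Ideal (MvPolynomial (ι × κ) K) := fun k ↦ Ideal.span (Set.range fun i ↦ X (k, i))
  have hB : ∏ k, B k ≤ (Ideal.span (Set.range f)).radical := by
    rw [← vanishingIdeal_zeroLocus_eq_radical (K := K)]
    intro p hp x hx
    obtain ⟨k, hk⟩ := hf x fun j ↦ by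
      simpa [aeval_eq_eval] using hx (f j) (Ideal.subset_span ⟨j, rfl⟩)
    have hle : B k ≤ vanishingIdeal K {x} := by
      rw [Ideal.span_le]
      rintro _ ⟨i, rfl⟩
      simp [hk i]
    have hp' : p ∈ B k := (Ideal.prod_le_inf.trans (Finset.inf_le (Finset.mem_univ k))) hp
    exact (mem_vanishingIdeal_singleton_iff x p).1 (hle hp')
  obtain ⟨e, he⟩ := Ideal.exists_pow_le_of_le_radical_of_fg hB (IsNoetherian.noetherian _)
  refine ⟨e, fun p hp ↦ he ?_⟩
  induction hp using IsWeightedHomogeneous.induction_on with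
  | zero => exact zero_mem _
  | add p q _ _ h₁ h₂ => exact add_mem h₁ h₂
  | monomial m r hr =>
    rw [monomial_eq, Finsupp.prod_fintype _ _ (by simp), Fintype.prod_prod_type,
      ← Finset.prod_pow]
    refine Ideal.mul_mem_left _ _ (Ideal.prod_mem_prod fun k _ ↦ ?_)
    have hk : e = ∑ i, m (k, i) := by rw [← weight_blockWeight_apply, hr]
    rw [hk, ← Finset.prod_pow_eq_pow_sum]
    exact Ideal.prod_mem_prod fun i _ ↦
      Ideal.pow_mem_pow (Ideal.subset_span (Set.mem_range_self i)) _

/-- If the multihomogeneous polynomials `f j` have no common zero in the product of projective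
spaces, then neither does the perturbation `m j + s * f j`, for all but finitely many `s`. -/
lemma finite_setOf_exists_eval_add_mul_eq_zero [Fintype ι] [Fintype κ] [Fintype J] [IsAlgClosed K]
    {D : J → ι → ℕ} {f m : J → MvPolynomial (ι × κ) K}
    (hfD : ∀ j, IsWeightedHomogeneous (blockWeight ι κ) (f j) (D j))
    (hmD : ∀ j, IsWeightedHomogeneous (blockWeight ι κ) (m j) (D j))
    (hf : ∀ x : ι × κ → K, (∀ j, eval x (f j) = 0) → ∃ k, ∀ i, x (k, i) = 0) :
    {s : K | ∃ x : ι × κ → K, (∀ k, ∃ i, x (k, i) ≠ 0) ∧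
      ∀ j, eval x (m j) + s * eval x (f j) = 0}.Finite := by
  obtain ⟨e, he⟩ := exists_mem_span_of_blockWeight hf
  let V := weightedHomogeneousSubmodule K (blockWeight ι κ) (fun _ ↦ e)
  have : FiniteDimensional K V := finiteDimensional_weightedHomogeneousSubmodule_blockWeight _
  have hT (p : V) : ∃ q : V, ∀ s (x : ι × κ → K), (∀ j, eval x (m j) + s * eval x (f j) = 0) →
      eval x (q : MvPolynomial (ι × κ) K) = s * eval x (p : MvPolynomial (ι × κ) K) := by
    obtain ⟨q, hpq, hq⟩ :=
      IsWeightedHomogeneous.exists_eq_sum_of_mem_span hfD p.2 (he p.1 p.2)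
    refine ⟨⟨-∑ j, q j * m j, neg_mem (sum_mem fun j _ ↦ hq j _ (hmD j))⟩, fun s x hx ↦ ?_⟩
    simp only [hpq, map_neg, map_sum, map_mul, Finset.mul_sum, ← Finset.sum_neg_distrib]
    refine Finset.sum_congr rfl fun j _ ↦ ?_
    linear_combination -(eval x (q j)) * hx j
  choose T₀ hT₀ using hT
  let b := Module.finBasis K V
  let T : Module.End K V := b.constr K (T₀ ∘ b)
  refine T.finite_setOf_dual_eigenvector.subset ?_
  rintro s ⟨x, hx, hs⟩
  let φ : Module.Dual K V := (aeval (R := K) x).toLinearMap ∘ₗ V.subtype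
  have hφ (p : V) : φ p = eval x (p : MvPolynomial (ι × κ) K) := by simp [φ, aeval_eq_eval]
  refine ⟨φ, fun h0 ↦ ?_, fun p ↦ ?_⟩
  · choose i hi using hx
    have hmem : (∏ k, X (k, i k) ^ e : MvPolynomial (ι × κ) K) ∈ V := by
      have := IsWeightedHomogeneous.prod (w := blockWeight ι κ) Finset.univ
        (fun k ↦ (X (k, i k) ^ e : MvPolynomial (ι × κ) K)) _
        fun k _ ↦ (isWeightedHomogeneous_X K (blockWeight ι κ) (k, i k)).pow e
      have hE : ∑ k, e • blockWeight ι κ (k, i k) = fun _ ↦ e := by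
        ext k
        simp [blockWeight, Pi.single_apply]
      rwa [hE] at this
    have := hφ ⟨_, hmem⟩
    simp only [h0, LinearMap.zero_apply, map_prod, map_pow, eval_X] at this
    exact Finset.prod_ne_zero_iff.2 (fun k _ ↦ pow_ne_zero e (hi k)) this.symm
  · have : φ ∘ₗ T = s • φ := b.ext fun l ↦ by
      simp [T, hφ, hT₀ (b l) s x hs]
    simpa using LinearMap.congr_fun this p

end Blocks

/-- The equation `y = -s • h y` is solvable for all small `s`. -/
lemma _root_.HasStrictFDerivAt.eventually_exists_add_smul_eq_zero {𝕜 E : Type*}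
    [NontriviallyNormedField 𝕜] [CompleteSpace 𝕜] [NormedAddCommGroup E] [NormedSpace 𝕜 E]
    [CompleteSpace E] {h : E → E} {h' : E →L[𝕜] E} (hh : HasStrictFDerivAt h h' 0) :
    ∀ᶠ s in 𝓝 (0 : 𝕜), ∃ y, y + s • h y = 0 := by
  let F : 𝕜 × E → 𝕜 × E := fun p ↦ (p.1, p.2 + p.1 • h p.2)
  have h₁ : HasStrictFDerivAt (Prod.fst : 𝕜 × E → 𝕜) (ContinuousLinearMap.fst 𝕜 𝕜 E) 0 :=
    hasStrictFDerivAt_fst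
  have h₂ : HasStrictFDerivAt (Prod.snd : 𝕜 × E → E) (ContinuousLinearMap.snd 𝕜 𝕜 E) 0 :=
    hasStrictFDerivAt_snd
  have hF := h₁.prodMk (h₂.add (h₁.smul (HasStrictFDerivAt.comp (0 : 𝕜 × E) hh h₂)))
  have hmap := hF.map_nhds_eq_of_surj <| LinearMap.range_eq_top.2 fun q ↦
    ⟨(q.1, q.2 - q.1 • h 0), by simp⟩
  have hmem : Set.range F ∈ 𝓝 ((0 : 𝕜), (0 : E)) := by
    have := image_mem_map (m := F) (univ_mem (f := 𝓝 (0 : 𝕜 × E)))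
    rw [Set.image_univ] at this
    have hle : 𝓝 ((0 : 𝕜), (0 : E)) ≤ Filter.map F (𝓝 0) := by simpa using hmap.ge
    exact hle this
  have hcont : Tendsto (fun s : 𝕜 ↦ (s, (0 : E))) (𝓝 0) (𝓝 (0, 0)) :=
    Continuous.tendsto (by fun_prop) 0
  filter_upwards [hcont hmem] with s hs
  obtain ⟨⟨t, y⟩, hty⟩ := hs
  obtain ⟨rfl, h0⟩ := Prod.mk.inj hty
  exact ⟨y, h0⟩

/-- Multihomogeneous equations on a product of copies of `ℙ^N` have a common solution as soon as
they can be matched injectively with the `N` coordinates of the factors, each equation being matched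
with a factor in which it has positive degree. -/
theorem exists_common_zero_of_blockWeight {ι J : Type*} [DecidableEq ι] [Fintype ι] [Fintype J]
    {N : ℕ} {D : J → ι → ℕ} {f : J → MvPolynomial (ι × Fin (N + 1)) ℂ}
    (hf : ∀ j, IsWeightedHomogeneous (blockWeight ι (Fin (N + 1))) (f j) (D j))
    (φ : J → ι × Fin N) (hφ : Function.Injective φ) (hD : ∀ j, D j (φ j).1 ≠ 0) :
    ∃ x : ι × Fin (N + 1) → ℂ, (∀ k, ∃ i, x (k, i) ≠ 0) ∧ ∀ j, eval x (f j) = 0 := by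
  classical
  by_contra! hcon
  have hD' (j) : blockWeight ι (Fin N) (φ j) ≤ D j := fun k ↦ by
    rw [blockWeight, Pi.single_apply]
    split_ifs with h
    · exact h ▸ Nat.one_le_iff_ne_zero.2 (hD j)
    · exact Nat.zero_le _
  choose E hE using fun j ↦ exists_add_of_le (hD' j)
  let m : J → MvPolynomial (ι × Fin (N + 1)) ℂ := fun j ↦
    X ((φ j).1, (φ j).2.succ) * ∏ k, X (k, 0) ^ E j k
  have hm (j) : IsWeightedHomogeneous (blockWeight ι (Fin (N + 1))) (m j) (D j) := by
    have := (isWeightedHomogeneous_X ℂ (blockWeight ι (Fin (N + 1)))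
        ((φ j).1, (φ j).2.succ)).mul <|
      IsWeightedHomogeneous.prod (w := blockWeight ι (Fin (N + 1))) Finset.univ
        (fun k ↦ (X (k, 0) ^ E j k : MvPolynomial _ ℂ)) _
        fun k _ ↦ (isWeightedHomogeneous_X ℂ (blockWeight ι (Fin (N + 1))) (k, 0)).pow _
    have hsum : ∑ k, E j k • blockWeight ι (Fin (N + 1)) (k, 0) = E j := by
      ext k
      simp [blockWeight, Pi.single_apply]
    rwa [hsum, show blockWeight ι (Fin (N + 1)) ((φ j).1, (φ j).2.succ) =
      blockWeight ι (Fin N) (φ j) from rfl, ← hE] at this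
  have hfin := finite_setOf_exists_eval_add_mul_eq_zero hf hm fun x hx ↦ by
    by_contra! h
    obtain ⟨j, hj⟩ := hcon x h
    exact hj (hx j)
  let pt : (J → ℂ) → ι × Fin (N + 1) → ℂ := fun y p ↦
    Fin.cases 1 (fun c ↦ ∑ j, if φ j = (p.1, c) then y j else 0) p.2
  have hpt0 (y k) : pt y (k, 0) = 1 := rfl
  have hpts (y k) (c : Fin N) : pt y (k, c.succ) = ∑ j, if φ j = (k, c) then y j else 0 := rfl
  have hptm (y j) : eval (pt y) (m j) = y j := by
    simp [m, hpt0, hpts, hφ.eq_iff]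
  have hdiff : HasStrictFDerivAt (fun y j ↦ eval (pt y) (f j))
      (fderiv ℂ (fun y j ↦ eval (pt y) (f j)) 0) 0 := by
    refine AnalyticAt.hasStrictFDerivAt (analyticAt_pi_iff.2 fun j ↦ ?_)
    refine AnalyticAt.aeval_mvPolynomial (f := pt) (fun ⟨k, i⟩ ↦ ?_) (f j)
    induction i using Fin.cases with
    | zero => exact analyticAt_const
    | succ c =>
      simp only [hpts]
      refine Finset.analyticAt_fun_sum _ fun j _ ↦ ?_
      split_ifs
      · exact (ContinuousLinearMap.proj (R := ℂ) (φ := fun _ : J ↦ ℂ) j).analyticAt 0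
      · exact analyticAt_const
  have hev := hdiff.eventually_exists_add_smul_eq_zero
  refine (infinite_of_mem_nhds (0 : ℂ) hev) (hfin.subset ?_)
  rintro s ⟨y, hy⟩
  refine ⟨pt y, fun k ↦ ⟨0, by simp [hpt0]⟩, fun j ↦ ?_⟩
  simpa [hptm] using congrFun hy j

section LinePolynomial

variable {n K A B : Type*} [Field K] [CommRing A] [Algebra K A] [CommRing B] [Algebra K B]

/-- The polynomial `G (p + T * q)` in the variable `T`. -/
noncomputable def linePolynomial_s1 (G : MvPolynomial n K) (p q : n → A) : Polynomial A :=
  aeval (fun i ↦ Polynomial.C (q i) * Polynomial.X + Polynomial.C (p i)) G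

lemma map_linePolynomial_s1 (ψ : A →ₐ[K] B) (G : MvPolynomial n K) (p q : n → A) :
    (linePolynomial_s1 G p q).map (ψ : A →+* B) =
      linePolynomial_s1 G (fun i ↦ ψ (p i)) (fun i ↦ ψ (q i)) := by
  have h := comp_aeval_apply (fun i ↦ Polynomial.C (q i) * Polynomial.X + Polynomial.C (p i))
    (Polynomial.mapAlgHom ψ) G
  simpa [linePolynomial_s1] using h

lemma eval_linePolynomial_s1 (G : MvPolynomial n K) (p q : n → K) (t : K) :
    (linePolynomial_s1 G p q).eval t = eval (p + t • q) G := by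
  have h := comp_aeval_apply (fun i ↦ Polynomial.C (q i) * Polynomial.X + Polynomial.C (p i))
    (Polynomial.aeval (R := K) t) G
  rw [linePolynomial_s1, ← Polynomial.coe_aeval_eq_eval, h, ← aeval_eq_eval]
  congr 2
  ext i
  simp only [map_add, map_mul, Polynomial.aeval_C, Polynomial.aeval_X, Pi.add_apply,
    Pi.smul_apply, smul_eq_mul, Algebra.algebraMap_self, RingHom.id_apply]
  ring

lemma IsHomogeneous.natDegree_linePolynomial_le {G : MvPolynomial n K} {d : ℕ}
    (hG : G.IsHomogeneous d) (p q : n → K) : (linePolynomial_s1 G p q).natDegree ≤ d := by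
  simpa [linePolynomial_s1] using aeval_natDegree_le G hG.totalDegree_le
    (fun i ↦ Polynomial.C (q i) * Polynomial.X + Polynomial.C (p i)) (n := 1)
    fun i ↦ Polynomial.natDegree_linear_le

/-- A form vanishes on the line through `p` and `q` if it vanishes at `q` and agrees with zero to
order `d` at `p` along this line. -/
lemma IsHomogeneous.eval_add_eq_zero_of_coeff_linePolynomial [Infinite K] {G : MvPolynomial n K}
    {d : ℕ} (hG : G.IsHomogeneous d) {p q : n → K}
    (hcoeff : ∀ i < d, (linePolynomial_s1 G p q).coeff i = 0) (hq : eval q G = 0) (a b : K) :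
    eval (a • p + b • q) G = 0 := by
  set c := (linePolynomial_s1 G p q).coeff d
  have hP : linePolynomial_s1 G p q = Polynomial.monomial d c := by
    ext i
    rw [Polynomial.coeff_monomial]
    split_ifs with h
    · rw [← h]
    · obtain h | h := lt_or_gt_of_ne (Ne.symm h)
      · exact hcoeff i h
      · exact Polynomial.coeff_eq_zero_of_natDegree_lt
          ((hG.natDegree_linePolynomial_le p q).trans_lt h)
  have hsmul (s : K) (x : n → K) : eval (s • x) G = s ^ d * eval x G := by
    simp only [eval_eq, Finset.mul_sum, Pi.smul_apply, smul_eq_mul, mul_pow,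
      Finset.prod_mul_distrib, Finset.prod_pow_eq_pow_sum]
    refine Finset.sum_congr rfl fun m hm ↦ ?_
    have hd : ∑ i ∈ m.support, m i = d := (hG.degree_eq_sum_deg_support hm).symm
    rw [hd]
    ring
  have hne (a b : K) (ha : a ≠ 0) : eval (a • p + b • q) G = c * b ^ d := by
    have h := eval_linePolynomial_s1 G p q (b / a)
    rw [hP, Polynomial.eval_monomial] at h
    have hab : a • p + b • q = a • (p + (b / a) • q) := by
      rw [smul_add, smul_smul, mul_div_cancel₀ _ ha]
    rw [hab, hsmul, ← h, div_pow]
    field_simp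
  have hc : c = 0 := by
    have h : linePolynomial_s1 G q p = Polynomial.C c := by
      refine Polynomial.eq_of_infinite_eval_eq _ _ ?_
      refine (Set.finite_singleton (0 : K)).infinite_compl.mono fun s hs ↦ ?_
      have := hne s 1 hs
      simpa [eval_linePolynomial_s1, add_comm] using this
    simpa [eval_linePolynomial_s1, hq] using (congrArg (Polynomial.eval 0) h).symm
  obtain rfl | ha := eq_or_ne a 0
  · simp [hsmul, hq]
  · simp [hne a b ha, hc]

end LinePolynomial

section Coefficients

variable {σ n K M : Type*} [Field K] [AddCommMonoid M] {w : σ → M} {α β : M}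

/-- The coefficient of `T ^ i` is weighted homogeneous of degree `(d - i) • α + i • β`, and it
vanishes for `i > d`. -/
def HasGradedCoeffs (w : σ → M) (α β : M) (d : ℕ) (P : Polynomial (MvPolynomial σ K)) :
    Prop :=
  ∀ i, (i ≤ d → IsWeightedHomogeneous w (P.coeff i) ((d - i) • α + i • β)) ∧
    (d < i → P.coeff i = 0)

lemma HasGradedCoeffs.const (c : K) :
    HasGradedCoeffs w α β 0 (Polynomial.C (MvPolynomial.C c)) := by
  refine fun i ↦ ⟨fun hi ↦ ?_, fun hi ↦ ?_⟩
  · obtain rfl : i = 0 := by lia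
    simpa using isWeightedHomogeneous_C w c
  · simp [Polynomial.coeff_C, hi.ne']

lemma HasGradedCoeffs.linear {p q : MvPolynomial σ K} (hp : IsWeightedHomogeneous w p α)
    (hq : IsWeightedHomogeneous w q β) :
    HasGradedCoeffs w α β 1 (Polynomial.C q * Polynomial.X + Polynomial.C p) := by
  refine fun i ↦ ⟨fun hi ↦ ?_, fun hi ↦ ?_⟩
  · interval_cases i
    · simpa using hp
    · simpa [Polynomial.coeff_C] using hq
  · simp [Polynomial.coeff_C, Polynomial.coeff_X, hi.ne, (zero_lt_one.trans hi).ne']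

lemma HasGradedCoeffs.mul {d e : ℕ} {P Q : Polynomial (MvPolynomial σ K)}
    (hP : HasGradedCoeffs w α β d P) (hQ : HasGradedCoeffs w α β e Q) :
    HasGradedCoeffs w α β (d + e) (P * Q) := by
  refine fun i ↦ ⟨fun hi ↦ ?_, fun hi ↦ ?_⟩
  · rw [Polynomial.coeff_mul]
    refine IsWeightedHomogeneous.sum _ _ _ fun ⟨a, b⟩ hab ↦ ?_
    rw [Finset.HasAntidiagonal.mem_antidiagonal] at hab
    dsimp only at hab ⊢
    obtain ha | ha := lt_or_ge d a
    · simpa [(hP a).2 ha] using isWeightedHomogeneous_zero K w _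
    obtain hb | hb := lt_or_ge e b
    · simpa [(hQ b).2 hb] using isWeightedHomogeneous_zero K w _
    have := ((hP a).1 ha).mul ((hQ b).1 hb)
    rwa [add_add_add_comm, ← add_smul, ← add_smul, hab,
      show d - a + (e - b) = d + e - i by lia] at this
  · rw [Polynomial.coeff_mul]
    refine Finset.sum_eq_zero fun ⟨a, b⟩ hab ↦ ?_
    rw [Finset.HasAntidiagonal.mem_antidiagonal] at hab
    dsimp only at hab ⊢
    obtain ha | hb : d < a ∨ e < b := by lia
    · rw [(hP a).2 ha, zero_mul]
    · rw [(hQ b).2 hb, mul_zero]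

lemma HasGradedCoeffs.pow {d : ℕ} {P : Polynomial (MvPolynomial σ K)}
    (hP : HasGradedCoeffs w α β d P) (e : ℕ) : HasGradedCoeffs w α β (e * d) (P ^ e) := by
  induction e with
  | zero => simpa using HasGradedCoeffs.const (w := w) (α := α) (β := β) (1 : K)
  | succ e ih => simpa [pow_succ, add_mul] using ih.mul hP

lemma HasGradedCoeffs.prod {ι : Type*} (s : Finset ι) {d : ι → ℕ}
    {P : ι → Polynomial (MvPolynomial σ K)} (hP : ∀ i ∈ s, HasGradedCoeffs w α β (d i) (P i)) :
    HasGradedCoeffs w α β (∑ i ∈ s, d i) (∏ i ∈ s, P i) := by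
  classical
  induction s using Finset.induction_on with
  | empty => simpa using HasGradedCoeffs.const (w := w) (α := α) (β := β) (1 : K)
  | insert i s his ih =>
    rw [Finset.sum_insert his, Finset.prod_insert his]
    exact (hP i (Finset.mem_insert_self i s)).mul
      (ih fun j hj ↦ hP j (Finset.mem_insert_of_mem hj))

lemma HasGradedCoeffs.sum {ι : Type*} (s : Finset ι) {d : ℕ}
    {P : ι → Polynomial (MvPolynomial σ K)} (hP : ∀ i ∈ s, HasGradedCoeffs w α β d (P i)) :
    HasGradedCoeffs w α β d (∑ i ∈ s, P i) := by
  refine fun i ↦ ⟨fun hi ↦ ?_, fun hi ↦ ?_⟩ <;> rw [Polynomial.finsetSum_coeff]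
  · exact IsWeightedHomogeneous.sum _ _ _ fun j hj ↦ (hP j hj i).1 hi
  · exact Finset.sum_eq_zero fun j hj ↦ (hP j hj i).2 hi

/-- The coefficients of `G (p + T * q)` are bihomogeneous in `p` and `q`. -/
lemma IsHomogeneous.isWeightedHomogeneous_coeff_linePolynomial {G : MvPolynomial n K} {d : ℕ}
    (hG : G.IsHomogeneous d) {p q : n → MvPolynomial σ K}
    (hp : ∀ i, IsWeightedHomogeneous w (p i) α) (hq : ∀ i, IsWeightedHomogeneous w (q i) β)
    {i : ℕ} (hi : i ≤ d) :
    IsWeightedHomogeneous w ((linePolynomial_s1 G p q).coeff i) ((d - i) • α + i • β) := by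
  suffices HasGradedCoeffs w α β d (linePolynomial_s1 G p q) from (this i).1 hi
  rw [linePolynomial_s1, aeval_def, eval₂_eq]
  refine HasGradedCoeffs.sum _ fun m hm ↦ ?_
  rw [hG.degree_eq_sum_deg_support hm, ← zero_add (∑ i ∈ m.support, m i)]
  refine (HasGradedCoeffs.const (coeff m G)).mul (HasGradedCoeffs.prod _ fun l _ ↦ ?_)
  simpa using (HasGradedCoeffs.linear (hp l) (hq l)).pow (m l)

end Coefficients

section Chain

variable {r : ℕ} {n K : Type*} [Field K]

/-- The members of a chain from `v` to `w` whose `r` intermediate members are generic points. -/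
noncomputable def chainPoint (r : ℕ) (v w : n → K) (k : ℕ) (i : n) :
    MvPolynomial (Fin r × n) K :=
  if k = 0 then C (v i) else if h : k - 1 < r then X (⟨k - 1, h⟩, i) else C (w i)

/-- The multidegree of the coordinates of `chainPoint r v w k`. -/
def chainDegree (r k : ℕ) (b : Fin r) : ℕ := if (b : ℕ) + 1 = k then 1 else 0

lemma isWeightedHomogeneous_chainPoint (v w : n → K) (k : ℕ) (i : n) :
    IsWeightedHomogeneous (blockWeight (Fin r) n) (chainPoint r v w k i) (chainDegree r k) := by
  unfold chainPoint
  split_ifs with hk h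
  · have : chainDegree r k = 0 := by
      ext b
      simp [chainDegree, hk]
    exact this ▸ isWeightedHomogeneous_C _ _
  · have : chainDegree r k = blockWeight (Fin r) n (⟨k - 1, h⟩, i) := by
      ext b
      simp only [chainDegree, blockWeight, Pi.single_apply, Fin.ext_iff]
      congr 1
      simp only [eq_iff_iff]
      lia
    exact this ▸ isWeightedHomogeneous_X _ _ _
  · have : chainDegree r k = 0 := by
      ext b
      simp only [chainDegree, Pi.zero_apply, ite_eq_right_iff]
      lia
    exact this ▸ isWeightedHomogeneous_C _ _

/-- Any two points of a hypersurface of degree `d ≤ r + 1` in `ℙ^(r + 2)` are connected by a chain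
of `r + 1` lines. -/
lemma exists_chain {d : ℕ} (hd : 1 ≤ d) (hdr : d ≤ r + 1) {G : MvPolynomial (Fin (r + 3)) ℂ}
    (hG : G.IsHomogeneous d) {v w : Fin (r + 3) → ℂ} (hv : v ≠ 0) (hw : w ≠ 0)
    (hGv : eval v G = 0) (hGw : eval w G = 0) :
    ∃ vs : ℕ → Fin (r + 3) → ℂ, vs 0 = v ∧ vs (r + 1) = w ∧ (∀ k, vs k ≠ 0) ∧
      ∀ k ≤ r, ∀ a b : ℂ, eval (a • vs k + b • vs (k + 1)) G = 0 := by
  let J := {p : Fin (r + 1) × Fin d // (p.1 : ℕ) ≠ 0 ∨ (p.2 : ℕ) ≠ 0}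
  let V := chainPoint r v w
  let D : J → Fin r → ℕ := fun j ↦
    (d - j.1.2) • chainDegree r j.1.1 + (j.1.2 : ℕ) • chainDegree r (j.1.1 + 1)
  let f : J → MvPolynomial (Fin r × Fin (r + 3)) ℂ := fun j ↦
    (linePolynomial_s1 G (V j.1.1) (V (j.1.1 + 1))).coeff j.1.2
  have hf (j) : IsWeightedHomogeneous (blockWeight (Fin r) (Fin (r + 3))) (f j) (D j) :=
    hG.isWeightedHomogeneous_coeff_linePolynomial (isWeightedHomogeneous_chainPoint v w _)
      (isWeightedHomogeneous_chainPoint v w _) j.1.2.2.le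
  let φ : J → Fin r × Fin (r + 2) := fun j ↦
    if h : (j.1.2 : ℕ) ≤ j.1.1 then (⟨j.1.1 - 1, by have := j.2; lia⟩, ⟨j.1.2, by lia⟩)
    else (⟨j.1.1, by lia⟩, ⟨j.1.2 + 1, by lia⟩)
  have hφ : Function.Injective φ := by
    rintro ⟨⟨⟨k, hk⟩, ⟨i, hi⟩⟩, h⟩ ⟨⟨⟨k', hk'⟩, ⟨i', hi'⟩⟩, h'⟩ heq
    dsimp only [φ] at heq
    refine Subtype.ext (Prod.ext (Fin.ext ?_) (Fin.ext ?_)) <;> dsimp only at h h' ⊢ <;>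
    split_ifs at heq <;> simp only [Prod.mk.injEq, Fin.mk.injEq] at heq <;> lia
  have hD (j) : D j (φ j).1 ≠ 0 := by
    obtain ⟨⟨⟨k, hk⟩, ⟨i, hi⟩⟩, h⟩ := j
    simp only [φ, D, Pi.add_apply, Pi.smul_apply, smul_eq_mul, chainDegree] at h ⊢
    split_ifs <;> dsimp only at * <;> lia
  obtain ⟨x, hx0, hx⟩ := exists_common_zero_of_blockWeight hf φ hφ hD
  let vs : ℕ → Fin (r + 3) → ℂ := fun k i ↦ eval x (V k i)
  have hvs0 : vs 0 = v := by
    ext i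
    simp [vs, V, chainPoint]
  have hvsr (k) (hk : r < k) : vs k = w := by
    ext i
    simp [vs, V, chainPoint, show k ≠ 0 by lia, show ¬ k - 1 < r by lia]
  have hcoeff (k) (hk : k ≤ r) (i) (hi : i < d) :
      (linePolynomial_s1 G (vs k) (vs (k + 1))).coeff i = 0 := by
    by_cases h : k ≠ 0 ∨ i ≠ 0
    · have h₁ := hx ⟨(⟨k, by lia⟩, ⟨i, hi⟩), h⟩
      have h₂ : (linePolynomial_s1 G (V k) (V (k + 1))).map (aeval (R := ℂ) x : _ →+* ℂ) =
          linePolynomial_s1 G (vs k) (vs (k + 1)) := map_linePolynomial_s1 (aeval x) G _ _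
      rw [← h₂, Polynomial.coeff_map]
      exact h₁
    · obtain ⟨rfl, rfl⟩ : k = 0 ∧ i = 0 := by lia
      simp [Polynomial.coeff_zero_eq_eval_zero, eval_linePolynomial_s1, hvs0, hGv]
  have hGvs (k) : eval (vs k) G = 0 := by
    obtain hk | hk := lt_or_ge r k
    · rw [hvsr k hk, hGw]
    · simpa [Polynomial.coeff_zero_eq_eval_zero, eval_linePolynomial_s1] using hcoeff k hk 0 hd
  refine ⟨vs, hvs0, hvsr _ (Nat.lt_succ_self r), fun k ↦ ?_, fun k hk ↦
    hG.eval_add_eq_zero_of_coeff_linePolynomial (hcoeff k hk) (hGvs (k + 1))⟩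
  obtain rfl | hk0 := eq_or_ne k 0
  · exact hvs0 ▸ hv
  obtain hk | hk := lt_or_ge r k
  · exact hvsr k hk ▸ hw
  · obtain ⟨i, hi⟩ := hx0 ⟨k - 1, by lia⟩
    refine fun h ↦ hi ?_
    simpa [vs, V, chainPoint, hk0, show k - 1 < r by lia] using congrFun h i

end Chain

end MvPolynomial

/-- A hypersurface of degree `d ≤ N - 1` in `ℙ^N` is rationally chain connected by
chains of lines of length at most `N - 1`. -/
theorem hypersurface_chain_connected
    (N : ℕ) (hN : 2 ≤ N) (d : ℕ) (hd1 : 1 ≤ d) (hdN : d ≤ N - 1)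
    (G : MvPolynomial (Fin (N + 1)) ℂ) (hG : G.IsHomogeneous d)
    (v w : Fin (N + 1) → ℂ) (hv : v ≠ 0) (hw : w ≠ 0)
    (hGv : MvPolynomial.eval v G = 0) (hGw : MvPolynomial.eval w G = 0) :
    ∃ vs : Fin (N - 1 + 1) → (Fin (N + 1) → ℂ),
      vs 0 = v ∧ vs (Fin.last (N - 1)) = w ∧ (∀ k, vs k ≠ 0) ∧
      ∀ (k : Fin (N - 1)) (a b : ℂ),
        MvPolynomial.eval (a • vs k.castSucc + b • vs k.succ) G = 0 := by
  obtain ⟨r, rfl⟩ := Nat.exists_eq_add_of_le' hN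
  obtain ⟨vs, h0, hr, hne, hline⟩ := MvPolynomial.exists_chain hd1 (by lia) hG hv hw hGv hGw
  exact ⟨fun k ↦ vs k, h0, hr, fun k ↦ hne k, fun k ↦ hline k (by lia)⟩
end

section
/- Let N ≥ 1, c ≥ 1 and l ≥ 2 be integers, and let G₁,…,G_c ∈ ℂ[x₀,…,x_N] be homogeneous polynomials with G_i of degree d_i ≥ 2. Assume l·(d₁·d₂·⋯·d_c) ≤ N(l−1) + c. Then any two points of the common projective zero locus X of G₁,…,G_c are connected inside X by a chain of lines of length at most l; i.e., for any nonzero v, w ∈ ℂ^{N+1} with G_i(v) = G_i(w) = 0 for all i, there exist nonzero vectors v₀,…,v_l ∈ ℂ^{N+1} with v₀ = v, v_l = w and G_i(a·v_{k−1} + b·v_k) = 0 for every i = 1,…,c, every k = 1,…,l and all a, b ∈ ℂ. -/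
/-- A system `y i = X * h i (y)` has a solution in formal power series. -/
theorem PowerSeries.exists_eq_X_mul_aeval {R σ : Type*} [CommRing R]
    (h : σ → MvPolynomial σ R) :
    ∃ y : σ → PowerSeries R, ∀ i, y i = PowerSeries.X * MvPolynomial.aeval y (h i) := by
  have aeval_congr : ∀ (I : Ideal (PowerSeries R)) (a b : σ → PowerSeries R)
      (_ : ∀ i, a i - b i ∈ I) (p : MvPolynomial σ R),
      MvPolynomial.aeval a p - MvPolynomial.aeval b p ∈ I := by
    intro I a b hab p
    rw [← Ideal.Quotient.eq]
    change (Ideal.Quotient.mkₐ R I) _ = (Ideal.Quotient.mkₐ R I) _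
    rw [MvPolynomial.comp_aeval_apply, MvPolynomial.comp_aeval_apply]
    congr 2
    funext i
    exact Ideal.Quotient.eq.mpr (hab i)
  let Y : ℕ → σ → PowerSeries R := fun n =>
    Nat.rec 0 (fun _ z i => PowerSeries.X * MvPolynomial.aeval z (h i)) n
  have Y_succ : ∀ n i, Y (n + 1) i = PowerSeries.X * MvPolynomial.aeval (Y n) (h i) :=
    fun n i => rfl
  have step_dvd : ∀ n i, PowerSeries.X ^ n ∣ Y (n + 1) i - Y n i := by
    intro n
    induction n with
    | zero => intro i; simp
    | succ n ih =>
      intro i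
      rw [Y_succ (n + 1), Y_succ n, ← mul_sub, pow_succ']
      refine mul_dvd_mul_left _ ?_
      rw [← Ideal.mem_span_singleton]
      exact aeval_congr _ _ _ (fun i => Ideal.mem_span_singleton.mpr (ih i)) _
  have le_dvd : ∀ n k i, PowerSeries.X ^ n ∣ Y (n + k) i - Y n i := by
    intro n k i
    induction k with
    | zero => simp
    | succ k ih =>
      have := dvd_add ((pow_dvd_pow PowerSeries.X (Nat.le_add_right n k)).trans
        (step_dvd (n + k) i)) ih
      simpa [add_assoc] using this
  let y : σ → PowerSeries R := fun i => PowerSeries.mk fun n => PowerSeries.coeff n (Y (n + 1) i)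
  have y_dvd : ∀ n i, PowerSeries.X ^ n ∣ y i - Y n i := by
    intro n i
    rw [PowerSeries.X_pow_dvd_iff]
    intro k hk
    obtain ⟨r, rfl⟩ := Nat.exists_eq_add_of_lt hk
    have := PowerSeries.X_pow_dvd_iff.mp (le_dvd (k + 1) r i) k (Nat.lt_succ_self k)
    rw [map_sub, sub_eq_zero] at this ⊢
    rw [show k + r + 1 = k + 1 + r by ring, this]
    simp [y]
  refine ⟨y, fun i => ?_⟩
  rw [← sub_eq_zero]
  ext n
  have h1 := y_dvd (n + 1) i
  have h2 : PowerSeries.X ^ (n + 1) ∣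
      PowerSeries.X * MvPolynomial.aeval y (h i) - Y (n + 1) i := by
    rw [Y_succ, ← mul_sub, pow_succ']
    refine mul_dvd_mul_left _ ?_
    rw [← Ideal.mem_span_singleton]
    exact aeval_congr _ _ _ (fun i => Ideal.mem_span_singleton.mpr (y_dvd n i)) _
  have h3 := dvd_sub h1 h2
  rw [sub_sub_sub_cancel_right] at h3
  simpa using PowerSeries.X_pow_dvd_iff.mp h3 n (Nat.lt_succ_self n)

/-- A transcendental element is a nonunit of some valuation subring containing the base field. -/
theorem Transcendental.exists_mem_nonunits_valuationSubring {k K : Type*} [Field k] [Field K]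
    [Algebra k K] {u : K} (hu : Transcendental k u) :
    ∃ V : ValuationSubring K, (∀ z, algebraMap k K z ∈ V) ∧ u ∈ V.nonunits := by
  let φ : Polynomial k →+* K := (Polynomial.aeval u).toRingHom
  have φ_inj : Function.Injective φ := transcendental_iff_injective.mp hu
  let I : Ideal φ.range := Ideal.map φ.rangeRestrict (Ideal.span {Polynomial.X})
  have I_ne_top : I ≠ ⊤ := by
    intro hI
    rw [Ideal.eq_top_iff_one, Ideal.mem_map_iff_of_surjective _ φ.rangeRestrict_surjective] at hI
    obtain ⟨p, hp, hp1⟩ := hI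
    have hp_one : p = 1 := φ_inj (by simpa using congrArg Subtype.val hp1)
    rw [hp_one, Ideal.mem_span_singleton] at hp
    exact Polynomial.not_isUnit_X (isUnit_of_dvd_one hp)
  obtain ⟨V, hV, hIV⟩ := Ideal.image_subset_nonunits_valuationSubring I I_ne_top
  refine ⟨V, fun z => hV ⟨Polynomial.C z, by simp [φ]⟩, hIV ⟨φ.rangeRestrict Polynomial.X, ?_, ?_⟩⟩
  · exact Ideal.mem_map_of_mem _ (Ideal.mem_span_singleton_self _)
  · exact Polynomial.aeval_X u

/-- Polynomial relations satisfied in an extension field are satisfied over an algebraically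
closed base field. -/
theorem MvPolynomial.exists_eval_eq_zero_of_eval₂_eq_zero {k κ σ : Type*} [Field k] [IsAlgClosed k]
    [Field κ] [Finite σ] (ρ : k →+* κ) (x : σ → κ) :
    ∃ z : σ → k, ∀ p, MvPolynomial.eval₂ ρ x p = 0 → MvPolynomial.eval z p = 0 := by
  obtain ⟨M, hM, hle⟩ := Ideal.exists_le_maximal _
    (RingHom.ker_ne_top (MvPolynomial.eval₂Hom ρ x))
  obtain ⟨z, hz⟩ := MvPolynomial.eq_vanishingIdeal_singleton_of_isMaximal k hM
  refine ⟨z, fun p hp => ?_⟩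
  have : p ∈ M := hle hp
  rw [hz, MvPolynomial.mem_vanishingIdeal_singleton_iff] at this
  simpa [MvPolynomial.aeval_eq_eval] using this

/-- A nonzero vector has a coordinate of maximal valuation. -/
theorem ValuationSubring.exists_forall_div_mem {K ι : Type*} [Field K] [Finite ι]
    (V : ValuationSubring K) (x : ι → K) (hx : x ≠ 0) :
    ∃ i, x i ≠ 0 ∧ ∀ j, x j / x i ∈ V := by
  obtain ⟨i₀, hi₀⟩ := Function.ne_iff.mp hx
  have : Nonempty ι := ⟨i₀⟩
  obtain ⟨i, hi⟩ := Finite.exists_max fun i => V.valuation (x i)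
  have hne : x i ≠ 0 := by
    intro h
    have := hi i₀
    rw [h, map_zero, le_zero_iff, map_eq_zero] at this
    exact hi₀ this
  refine ⟨i, hne, fun j => (V.valuation_le_one_iff _).mp ?_⟩
  rw [map_div₀]
  exact div_le_one_of_le₀ (hi j) zero_le

theorem PowerSeries.transcendental_inv_algebraMap_X {k K : Type*} [Field k] [Field K]
    [Algebra (PowerSeries k) K] [Algebra k K] [IsScalarTower k (PowerSeries k) K]
    [FaithfulSMul (PowerSeries k) K] :
    Transcendental k (algebraMap (PowerSeries k) K PowerSeries.X)⁻¹ := by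
  intro h
  have h1 := h.inv
  rw [inv_inv] at h1
  have h2 : IsAlgebraic k (PowerSeries.X : PowerSeries k) :=
    (isAlgebraic_algebraMap_iff (FaithfulSMul.algebraMap_injective _ _)).mp h1
  obtain ⟨p, hp, hp0⟩ := h2
  apply hp
  apply Polynomial.coe_injective k
  have : ∀ q : Polynomial k, Polynomial.aeval (PowerSeries.X : PowerSeries k) q = q := by
    intro q
    have : Polynomial.aeval (PowerSeries.X : PowerSeries k) =
        (Polynomial.coeToPowerSeries.algHom k : Polynomial k →ₐ[k] PowerSeries k) := by
      ext; simp
    rw [this]; simp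
  rw [← this, hp0]; simp

/-- Scaling the argument of a homogeneous polynomial. -/
theorem MvPolynomial.IsHomogeneous.aeval_const_mul {R S σ : Type*} [CommSemiring R]
    [CommSemiring S] [Algebra R S] {G : MvPolynomial σ R} {d : ℕ} (hG : G.IsHomogeneous d)
    (c : S) (z : σ → S) :
    MvPolynomial.aeval (fun s => c * z s) G = c ^ d * MvPolynomial.aeval z G := by
  rw [MvPolynomial.aeval_def, MvPolynomial.aeval_def, MvPolynomial.eval₂_eq,
    MvPolynomial.eval₂_eq, Finset.mul_sum]
  refine Finset.sum_congr rfl fun m hm => ?_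
  have hdeg : ∑ i ∈ m.support, m i = d := by
    have := hG (MvPolynomial.mem_support_iff.mp hm)
    rwa [Pi.one_def, ← Finsupp.degree_eq_weight_one] at this
  simp only [mul_pow, Finset.prod_mul_distrib, Finset.prod_pow_eq_pow_sum, hdeg]
  ring

/-- The restriction of `G` to the line through `u` with direction `w`, as a polynomial in the
parameter. -/
noncomputable def lineRestriction {R S σ : Type*} [CommRing R] [CommRing S] [Algebra R S]
    (u w : σ → S) (G : MvPolynomial σ R) : Polynomial S :=
  MvPolynomial.aeval (fun s => Polynomial.C (u s) + Polynomial.C (w s) * Polynomial.X) G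

section lineRestriction

variable {R S T σ : Type*} [CommRing R] [CommRing S] [Algebra R S] [CommRing T] [Algebra R T]

theorem map_lineRestriction (φ : S →ₐ[R] T) (u w : σ → S) (G : MvPolynomial σ R) :
    (lineRestriction u w G).map (φ : S →+* T) =
      lineRestriction (fun s => φ (u s)) (fun s => φ (w s)) G := by
  have := MvPolynomial.comp_aeval_apply
    (f := fun s => Polynomial.C (u s) + Polynomial.C (w s) * Polynomial.X)
    (Polynomial.mapAlgHom φ) G
  simpa [lineRestriction] using this

theorem eval_lineRestriction (u w : σ → S) (G : MvPolynomial σ R) (t : S) :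
    (lineRestriction u w G).eval t = MvPolynomial.aeval (fun s => u s + w s * t) G := by
  have := MvPolynomial.comp_aeval_apply
    (f := fun s => Polynomial.C (u s) + Polynomial.C (w s) * Polynomial.X)
    ((Polynomial.aeval t).restrictScalars R : Polynomial S →ₐ[R] S) G
  simpa [lineRestriction, Polynomial.aeval_def, Polynomial.eval₂_eq_eval_map] using this

theorem lineRestriction_comp (u w : σ → S) (G : MvPolynomial σ R) (t : S) :
    (lineRestriction u w G).comp (Polynomial.C t * Polynomial.X) =
      lineRestriction u (fun s => t * w s) G := by
  have := MvPolynomial.comp_aeval_apply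
    (f := fun s => Polynomial.C (u s) + Polynomial.C (w s) * Polynomial.X)
    ((Polynomial.aeval (Polynomial.C t * Polynomial.X)).restrictScalars R :
      Polynomial S →ₐ[R] Polynomial S) G
  simp only [AlgHom.restrictScalars_apply, ← Polynomial.comp_eq_aeval] at this
  rw [lineRestriction, this, lineRestriction]
  congr 2
  funext s
  simp
  ring

theorem lineRestriction_const_mul {G : MvPolynomial σ R} {d : ℕ} (hG : G.IsHomogeneous d)
    (u w : σ → S) (t : S) :
    lineRestriction (fun s => t * u s) (fun s => t * w s) G =
      Polynomial.C t ^ d * lineRestriction u w G := by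
  rw [lineRestriction, lineRestriction, ← hG.aeval_const_mul]
  congr 2
  funext s
  simp
  ring

theorem coeff_lineRestriction_mul {K : Type*} [Field K] [Algebra R K] {G : MvPolynomial σ R}
    {d j : ℕ} (hG : G.IsHomogeneous d) (hj : j ≤ d) (u w : σ → K) {a b : K} (ha : a ≠ 0) :
    (lineRestriction (fun s => a * u s) (fun s => b * w s) G).coeff j =
      a ^ (d - j) * b ^ j * (lineRestriction u w G).coeff j := by
  have h : (fun s => b * w s) = fun s => a * (b / a * w s) := by
    funext s; field_simp
  rw [h, lineRestriction_const_mul hG, ← lineRestriction_comp, ← Polynomial.C_pow,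
    Polynomial.coeff_C_mul, Polynomial.comp_C_mul_X_coeff, div_pow]
  have : a ^ d = a ^ (d - j) * a ^ j := by rw [← pow_add, Nat.sub_add_cancel hj]
  rw [this]
  field_simp

/-- A form vanishing at two points vanishes on the line joining them as soon as the intermediate
coefficients of its restriction to the line vanish. -/
theorem aeval_line_eq_zero {K : Type*} [Field K] [Infinite K] {G : MvPolynomial σ K} {d : ℕ}
    (hG : G.IsHomogeneous d) (u w : σ → K) (hu : MvPolynomial.eval u G = 0)
    (hw : MvPolynomial.eval w G = 0)
    (hcoeff : ∀ j, 0 < j → j < d → (lineRestriction u w G).coeff j = 0) (a b : K) :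
    MvPolynomial.eval (a • u + b • w) G = 0 := by
  have hdeg : (lineRestriction u w G).natDegree ≤ d := by
    have := MvPolynomial.aeval_natDegree_le (m := d) (n := 1) G hG.totalDegree_le
      (fun s => Polynomial.C (u s) + Polynomial.C (w s) * Polynomial.X) (fun s => by compute_degree)
    simpa [lineRestriction] using this
  obtain ⟨q, hq⟩ : ∃ q, lineRestriction u w G = Polynomial.C q * Polynomial.X ^ d := by
    refine ⟨(lineRestriction u w G).coeff d, ?_⟩
    ext j
    rw [Polynomial.coeff_C_mul, Polynomial.coeff_X_pow]
    rcases lt_trichotomy j d with hj | rfl | hj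
    · rw [if_neg hj.ne, mul_zero]
      rcases Nat.eq_zero_or_pos j with rfl | hj0
      · rw [Polynomial.coeff_zero_eq_eval_zero, eval_lineRestriction]
        simpa [MvPolynomial.aeval_eq_eval] using hu
      · exact hcoeff j hj0 hj
    · simp
    · rw [if_neg hj.ne', mul_zero]
      exact Polynomial.coeff_eq_zero_of_natDegree_lt (hdeg.trans_lt hj)
  have heval : ∀ a b : K, a ≠ 0 → MvPolynomial.eval (a • u + b • w) G = q * b ^ d := by
    intro a b ha
    have h1 := hG.aeval_const_mul a (fun s => u s + w s * (b / a))
    rw [← eval_lineRestriction, hq] at h1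
    have h2 : a • u + b • w = fun s => a * (u s + w s * (b / a)) := by
      funext s
      simp
      field_simp
    rw [h2, ← MvPolynomial.aeval_eq_eval]
    simp only [h1, Polynomial.eval_mul, Polynomial.eval_C, Polynomial.eval_pow, Polynomial.eval_X]
    rw [div_pow]
    field_simp
  have hq0 : q = 0 := by
    have hpoly : (lineRestriction w u G - Polynomial.C q) * Polynomial.X = 0 := by
      refine Polynomial.funext fun t => ?_
      rw [Polynomial.eval_mul, Polynomial.eval_X, Polynomial.eval_zero]
      rcases eq_or_ne t 0 with rfl | ht
      · simp
      · have := heval t 1 ht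
        rw [Polynomial.eval_sub, eval_lineRestriction, Polynomial.eval_C,
          MvPolynomial.aeval_eq_eval]
        have h2 : (fun s => w s + u s * t) = t • u + (1 : K) • w := by
          funext s
          simp
          ring
        rw [h2, this]
        simp
    have h3 := (mul_eq_zero.mp hpoly).resolve_right Polynomial.X_ne_zero
    have h4 := congrArg (Polynomial.eval 0) h3
    rw [Polynomial.eval_sub, eval_lineRestriction, Polynomial.eval_C,
      MvPolynomial.aeval_eq_eval] at h4
    simpa [hw] using h4
  rcases eq_or_ne a 0 with rfl | ha
  · have := hG.aeval_const_mul b w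
    rw [MvPolynomial.aeval_eq_eval] at this
    have h2 : (0 : K) • u + b • w = fun s => b * w s := by
      funext s
      simp
    rw [h2]
    simpa [hw] using this
  · rw [heval a b ha, hq0, zero_mul]

end lineRestriction

theorem Finset.sum_le_prod_of_two_le {ι : Type*} (s : Finset ι) (d : ι → ℕ)
    (hd : ∀ i ∈ s, 2 ≤ d i) : ∑ i ∈ s, d i ≤ ∏ i ∈ s, d i := by
  classical
  suffices ∑ i ∈ s, d i ≤ ∏ i ∈ s, d i ∧ (2 ≤ ∏ i ∈ s, d i ∨ ∑ i ∈ s, d i = 0) from this.1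
  induction s using Finset.induction_on with
  | empty => simp
  | insert a s ha ih =>
    obtain ⟨h1, h2⟩ := ih fun i hi => hd i (Finset.mem_insert_of_mem hi)
    have h3 := hd a (Finset.mem_insert_self a s)
    have h4 : 0 < ∏ i ∈ s, d i :=
      Finset.prod_pos fun i hi => by have := hd i (Finset.mem_insert_of_mem hi); omega
    rw [Finset.sum_insert ha, Finset.prod_insert ha]
    refine ⟨?_, Or.inl (by nlinarith)⟩
    rcases h2 with h2 | h2
    · nlinarith
    · rw [h2]
      nlinarith

/-- Distribute `r` items from each of the `m + 1` edges of a path to the end points of the edge,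
where the `m` interior vertices have `N` slots of which `c` are occupied. -/
theorem exists_injective_slot_assignment_s2 {m r c N : ℕ} (hcap : (m + 1) * r + m * c ≤ N * m)
    (hm : 1 ≤ m) :
    ∃ σ : (Fin (m + 1) × Fin r) ⊕ (Fin m × Fin c) → Fin m × Fin N, Function.Injective σ ∧
      (∀ a i, (σ (Sum.inr (a, i))).1 = a) ∧
      ∀ k q, ((σ (Sum.inl (k, q))).1 : ℕ) = k ∨ ((σ (Sum.inl (k, q))).1 : ℕ) + 1 = k := by
  obtain ⟨e, he⟩ : ∃ e, N = c + r + e := by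
    refine Nat.exists_eq_add_of_le ?_
    by_contra! hlt
    nlinarith
  have hre : r ≤ m * e := by subst he; nlinarith
  obtain ⟨x, hx0, hxm, hxs, hxr⟩ : ∃ x : ℕ → ℕ, x 0 = 0 ∧ x m = r ∧ (∀ k, x (k + 1) ≤ x k + e) ∧
      ∀ k, x k ≤ r := by
    refine ⟨fun k => min r (k * e), by simp, by simpa using hre, fun k => ?_, fun k => by simp⟩
    have : (k + 1) * e = k * e + e := by ring
    simp only [this]
    omega
  have ha : ∀ (k : Fin (m + 1)) (q : Fin r), (q : ℕ) < x k → 0 < (k : ℕ) := by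
    intro k q h
    rcases Nat.eq_zero_or_pos (k : ℕ) with h0 | h0
    · rw [h0, hx0] at h; omega
    · exact h0
  have hb : ∀ (k : Fin (m + 1)) (q : Fin r), ¬ (q : ℕ) < x k → (k : ℕ) < m := by
    intro k q h
    rcases (Nat.lt_succ_iff.mp k.2).lt_or_eq with h0 | h0
    · exact h0
    · rw [h0, hxm] at h; omega
  have hprev : ∀ (k : Fin (m + 1)) (q : Fin r), (q : ℕ) < x k →
      c + (r - x (k - 1)) + q < N := by
    intro k q h
    have h0 := ha k q h
    have h1 := hxs (k - 1)
    rw [Nat.sub_add_cancel h0] at h1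
    have := hxr (k - 1)
    omega
  refine ⟨Sum.elim (fun p => if h : (p.2 : ℕ) < x p.1 then
      (⟨p.1 - 1, by have := ha p.1 p.2 h; omega⟩, ⟨c + (r - x (p.1 - 1)) + p.2, hprev _ _ h⟩)
      else (⟨p.1, hb _ _ h⟩, ⟨c + (p.2 - x p.1), by omega⟩))
      (fun p => (p.1, ⟨p.2, by omega⟩)), ?_, ?_, ?_⟩
  · rintro (⟨k, q⟩ | ⟨k, q⟩) (⟨k', q'⟩ | ⟨k', q'⟩) h
    · simp only [Sum.elim_inl] at h
      split_ifs at h with h1 h2 h2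
      · have := ha _ _ h1
        have := ha _ _ h2
        simp only [Prod.mk.injEq, Fin.mk.injEq] at h
        obtain ⟨h3, h4⟩ := h
        rw [h3] at h4
        simp only [Sum.inl.injEq, Prod.mk.injEq, Fin.ext_iff]
        omega
      · have := ha _ _ h1
        simp only [Prod.mk.injEq, Fin.mk.injEq] at h
        obtain ⟨h3, h4⟩ := h
        rw [h3] at h4
        omega
      · have := ha _ _ h2
        simp only [Prod.mk.injEq, Fin.mk.injEq] at h
        obtain ⟨h3, h4⟩ := h
        rw [← h3] at h4
        omega
      · simp only [Prod.mk.injEq, Fin.mk.injEq] at h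
        obtain ⟨h3, h4⟩ := h
        rw [h3] at h4 h1
        simp only [Sum.inl.injEq, Prod.mk.injEq, Fin.ext_iff]
        omega
    · simp only [Sum.elim_inl, Sum.elim_inr] at h
      split_ifs at h with h1 <;> simp only [Prod.mk.injEq, Fin.ext_iff] at h <;> omega
    · simp only [Sum.elim_inl, Sum.elim_inr] at h
      split_ifs at h with h1 <;> simp only [Prod.mk.injEq, Fin.ext_iff] at h <;> omega
    · simpa [Prod.ext_iff, Fin.ext_iff] using h
  · intro a i
    rfl
  · intro k q
    simp only [Sum.elim_inl]
    split_ifs with h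
    · have := ha _ _ h
      right
      change (k : ℕ) - 1 + 1 = k
      omega
    · exact Or.inl rfl

/-- Solvability of a system of equations on a product of projective spaces `ℙ ^ N` indexed by `A`.
Every equation is multihomogeneous, and the equations are assigned injectively to the affine
coordinates of the factors so that the equation `f j` has positive degree in the factor
`(σ j).1`. -/
theorem exists_common_zero_of_multihomogeneous {A J : Type*} [Finite A] {N : ℕ}
    (f : J → MvPolynomial (A × Fin (N + 1)) ℂ) (σ : J → A × Fin N) (hσ : Function.Injective σ)
    (hf : ∀ j, ∃ M : MvPolynomial A ℂ, ∀ (K : Type) [Field K] [Algebra ℂ K] (μ : A → K)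
      (x : A × Fin (N + 1) → K), (∀ a, μ a ≠ 0) →
      MvPolynomial.aeval (fun p => μ p.1 * x p) (f j) =
        μ (σ j).1 * MvPolynomial.aeval μ M * MvPolynomial.aeval x (f j)) :
    ∃ z : A × Fin (N + 1) → ℂ, (∀ a, ∃ i, z (a, i) ≠ 0) ∧
      ∀ j, MvPolynomial.aeval z (f j) = 0 := by
  choose M hM using hf
  let D : A × Fin (N + 1) → MvPolynomial (A × Fin N) ℂ := fun p =>
    Fin.cases 1 (fun i => MvPolynomial.X (p.1, i)) p.2
  obtain ⟨y, hy⟩ := PowerSeries.exists_eq_X_mul_aeval fun q : A × Fin N =>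
    -MvPolynomial.aeval D (Function.extend σ f 0 q)
  let K := FractionRing (PowerSeries ℂ)
  let ι : PowerSeries ℂ →ₐ[ℂ] K := IsScalarTower.toAlgHom ℂ _ K
  have ι_inj : Function.Injective ι := FaithfulSMul.algebraMap_injective _ _
  let x : A × Fin (N + 1) → K := fun p => ι (MvPolynomial.aeval y (D p))
  let u : K := (ι PowerSeries.X)⁻¹
  have hs : ι PowerSeries.X ≠ 0 := by
    rw [map_ne_zero_iff _ ι_inj]
    exact PowerSeries.X_ne_zero
  have hx0 : ∀ a, x (a, 0) = 1 := fun a => by simp [x, D]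
  have hx : ∀ j, MvPolynomial.aeval x (f j) = -(u * x ((σ j).1, (σ j).2.succ)) := by
    intro j
    have h1 := congrArg ι (hy (σ j))
    rw [hσ.extend_apply, map_neg, map_mul, map_neg, MvPolynomial.comp_aeval_apply,
      MvPolynomial.comp_aeval_apply] at h1
    have h2 : x ((σ j).1, (σ j).2.succ) = ι (y (σ j)) := by simp [x, D]
    rw [h2, h1]
    rw [mul_neg, mul_neg, neg_neg, inv_mul_cancel_left₀ hs]
    simp only [x, MvPolynomial.comp_aeval_apply]
  obtain ⟨V, hV, huV⟩ := Transcendental.exists_mem_nonunits_valuationSubring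
    (PowerSeries.transcendental_inv_algebraMap_X (k := ℂ) (K := K))
  replace huV : u ∈ V.nonunits := huV
  have hmax : ∀ a, ∃ i, x (a, i) ≠ 0 ∧ ∀ i', x (a, i') / x (a, i) ∈ V := fun a =>
    V.exists_forall_div_mem (fun i => x (a, i)) fun h => by simpa [hx0] using congrFun h 0
  choose i₀ hi_ne hdiv using hmax
  let φ : ℂ →+* V := (algebraMap ℂ K).codRestrict V.toSubring hV
  have coe_eval₂ : ∀ {τ : Type _} (t : τ → V) (p : MvPolynomial τ ℂ),
      ((MvPolynomial.eval₂ φ t p : V) : K) = MvPolynomial.aeval (fun q => (t q : K)) p := by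
    intro τ t p
    exact MvPolynomial.eval₂_comp_left V.subtype φ t p
  let μ : A → V := fun a => ⟨(x (a, i₀ a))⁻¹, by simpa [hx0] using hdiv a 0⟩
  let z : A × Fin (N + 1) → V := fun p =>
    ⟨(x (p.1, i₀ p.1))⁻¹ * x p, by simpa [div_eq_inv_mul] using hdiv p.1 p.2⟩
  have hz : ∀ j, MvPolynomial.eval₂ φ z (f j) =
      -(MvPolynomial.eval₂ φ μ (M j) * z ((σ j).1, (σ j).2.succ) * ⟨u, V.nonunits_subset huV⟩) := by
    intro j
    apply Subtype.val_injective
    have h1 := hM j K (fun a => (μ a : K)) x fun a => inv_ne_zero (hi_ne a)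
    rw [hx] at h1
    push_cast
    rw [coe_eval₂, coe_eval₂]
    refine Eq.trans h1 ?_
    simp only [μ, z]
    ring
  let res := IsLocalRing.residue V
  obtain ⟨t, ht⟩ := MvPolynomial.exists_eval_eq_zero_of_eval₂_eq_zero (res.comp φ)
    fun p => res (z p)
  refine ⟨t, fun a => ⟨i₀ a, ?_⟩, fun j => ?_⟩
  · have h1 : z (a, i₀ a) = 1 := Subtype.val_injective (inv_mul_cancel₀ (hi_ne a))
    have h2 := ht (MvPolynomial.X (a, i₀ a) - MvPolynomial.C 1) (by
      rw [MvPolynomial.eval₂_sub, MvPolynomial.eval₂_X, MvPolynomial.eval₂_C, h1]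
      simp)
    rw [map_sub, MvPolynomial.eval_X, MvPolynomial.eval_C, sub_eq_zero] at h2
    rw [h2]
    exact one_ne_zero
  · rw [MvPolynomial.aeval_eq_eval]
    refine ht _ ?_
    have h1 := MvPolynomial.eval₂_comp_left res φ z (f j)
    refine h1.symm.trans ?_
    rw [hz, IsLocalRing.residue_eq_zero_iff]
    exact neg_mem (Ideal.mul_mem_left _ _ (V.coe_mem_nonunits_iff.mp huV))

/-- The sequence starting with `v`, followed by the values of `f`, and ending with `w`. -/
def chainOf {α : Type*} {m : ℕ} (v w : α) (f : Fin m → α) : Fin (m + 2) → α :=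
  Fin.cons (α := fun _ => α) v (Fin.snoc (α := fun _ => α) f w)

section chainOf

variable {α : Type*} {m : ℕ} (v w : α) (f : Fin m → α)

@[simp]
theorem chainOf_zero : chainOf v w f 0 = v := rfl

@[simp]
theorem chainOf_last : chainOf v w f (Fin.last (m + 1)) = w := by
  simp [chainOf, ← Fin.succ_last]

@[simp]
theorem chainOf_castSucc_succ (a : Fin m) : chainOf v w f a.castSucc.succ = f a := by
  simp [chainOf]

theorem forall_chainOf {P : Fin (m + 2) → Prop} (h0 : P 0) (hlast : P (Fin.last (m + 1)))
    (h : ∀ a : Fin m, P a.castSucc.succ) (k : Fin (m + 2)) : P k := by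
  induction k using Fin.cases with
  | zero => exact h0
  | succ k =>
    induction k using Fin.lastCases with
    | last => exact hlast
    | cast a => exact h a

end chainOf

/-- Complete-intersection version: if `l * ∏ d i ≤ N * (l-1) + c` (with each `d i ≥ 2`),
then the common zero locus of the `G i` is chain connected by chains of lines of length
at most `l`. -/
theorem complete_intersection_chain_connected
    (N c l : ℕ) (hN : 1 ≤ N) (hc : 1 ≤ c) (hl : 2 ≤ l)
    (d : Fin c → ℕ) (hd : ∀ i, 2 ≤ d i)
    (G : Fin c → MvPolynomial (Fin (N + 1)) ℂ)
    (hG : ∀ i, (G i).IsHomogeneous (d i))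
    (hnum : l * (∏ i, d i) ≤ N * (l - 1) + c)
    (v w : Fin (N + 1) → ℂ) (hv : v ≠ 0) (hw : w ≠ 0)
    (hGv : ∀ i, MvPolynomial.eval v (G i) = 0)
    (hGw : ∀ i, MvPolynomial.eval w (G i) = 0) :
    ∃ vs : Fin (l + 1) → (Fin (N + 1) → ℂ),
      vs 0 = v ∧ vs (Fin.last l) = w ∧ (∀ k, vs k ≠ 0) ∧
      ∀ (i : Fin c) (k : Fin l) (a b : ℂ),
        MvPolynomial.eval (a • vs k.castSucc + b • vs k.succ) (G i) = 0 := by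
  obtain ⟨m, rfl⟩ : ∃ m, l = m + 1 := ⟨l - 1, by omega⟩
  have hsum : ∑ i, (d i - 1) + c = ∑ i, d i := by
    have : ∀ i, d i = (d i - 1) + 1 := fun i => by have := hd i; omega
    conv_rhs => rw [Finset.sum_congr rfl fun i _ => this i, Finset.sum_add_distrib]
    simp
  have hcap : (m + 1) * ∑ i, (d i - 1) + m * c ≤ N * m := by
    have h1 := Finset.sum_le_prod_of_two_le Finset.univ d fun i _ => hd i
    have h2 := Nat.mul_le_mul_left (m + 1) h1
    rw [← hsum] at h2
    simp only [Nat.add_sub_cancel] at hnum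
    nlinarith
  obtain ⟨σ, hσ, hσr, hσl⟩ := exists_injective_slot_assignment_s2 hcap (by omega)
  let P : Fin (m + 2) → Fin (N + 1) → MvPolynomial (Fin m × Fin (N + 1)) ℂ :=
    chainOf (fun s => MvPolynomial.C (v s)) (fun s => MvPolynomial.C (w s))
      fun a s => MvPolynomial.X (a, s)
  let p : Fin (m + 2) → MvPolynomial (Fin m) ℂ := chainOf 1 1 MvPolynomial.X
  let f : (Fin (m + 1) × Fin (∑ i, (d i - 1))) ⊕ (Fin m × Fin c) →
      MvPolynomial (Fin m × Fin (N + 1)) ℂ :=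
    Sum.elim (fun e => (lineRestriction (P e.1.castSucc) (P e.1.succ)
        (G (finSigmaFinEquiv.symm e.2).1)).coeff ((finSigmaFinEquiv.symm e.2).2 + 1))
      fun e => MvPolynomial.rename (fun s => (e.1, s)) (G e.2)
  have aeval_coeff : ∀ {K : Type} [Field K] [Algebra ℂ K] (x : Fin m × Fin (N + 1) → K)
      (k k' : Fin (m + 2)) (i : Fin c) (j : ℕ),
      MvPolynomial.aeval x ((lineRestriction (P k) (P k') (G i)).coeff j) =
        (lineRestriction (fun s => MvPolynomial.aeval x (P k s))
          (fun s => MvPolynomial.aeval x (P k' s)) (G i)).coeff j := by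
    intro K _ _ x k k' i j
    rw [← map_lineRestriction, Polynomial.coeff_map]
    rfl
  obtain ⟨z, hz0, hz⟩ := exists_common_zero_of_multihomogeneous f σ hσ (by
    rintro (⟨k, q⟩ | ⟨a, i⟩)
    · set i := (finSigmaFinEquiv.symm q).1 with hi
      set r := (finSigmaFinEquiv.symm q).2 with hr
      have hrd : (r : ℕ) + 1 + 1 ≤ d i := by
        have : (r : ℕ) < d i - 1 := r.2
        omega
      have key : ∀ (K : Type) [Field K] [Algebra ℂ K] (μ : Fin m → K)
          (x : Fin m × Fin (N + 1) → K), (∀ a, μ a ≠ 0) →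
          MvPolynomial.aeval (fun p => μ p.1 * x p) (f (Sum.inl (k, q))) =
            MvPolynomial.aeval μ (p k.castSucc) ^ (d i - (r + 1)) *
              MvPolynomial.aeval μ (p k.succ) ^ ((r : ℕ) + 1) *
              MvPolynomial.aeval x (f (Sum.inl (k, q))) := by
        intro K _ _ μ x hμ
        have hP : ∀ k s, MvPolynomial.aeval (fun p => μ p.1 * x p) (P k s) =
            MvPolynomial.aeval μ (p k) * MvPolynomial.aeval x (P k s) := fun k s =>
          forall_chainOf (P := fun k => MvPolynomial.aeval (fun p => μ p.1 * x p) (P k s) =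
            MvPolynomial.aeval μ (p k) * MvPolynomial.aeval x (P k s))
            (by simp [P, p]) (by simp [P, p]) (fun a => by simp [P, p]) k
        have hp : ∀ k, MvPolynomial.aeval μ (p k) ≠ 0 :=
          forall_chainOf (by simp [p]) (by simp [p]) fun a => by simpa [p] using hμ a
        simp only [f, Sum.elim_inl, aeval_coeff, hP]
        exact coeff_lineRestriction_mul (hG i) (by omega) _ _ (hp _)
      rcases hσl k q with h | h
      · have hk : k.succ = (σ (Sum.inl (k, q))).1.castSucc.succ := by
          ext
          simp [h]
        refine ⟨p k.castSucc ^ (d i - (r + 1)) *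
          MvPolynomial.X (σ (Sum.inl (k, q))).1 ^ (r : ℕ), fun K _ _ μ x hμ => ?_⟩
        rw [key K μ x hμ]
        have hps : p k.succ = MvPolynomial.X (σ (Sum.inl (k, q))).1 := by
          rw [hk]
          simp [p]
        rw [hps]
        simp only [map_mul, map_pow, MvPolynomial.aeval_X]
        ring
      · have hk : k.castSucc = (σ (Sum.inl (k, q))).1.castSucc.succ := by
          ext
          simp [← h]
        refine ⟨MvPolynomial.X (σ (Sum.inl (k, q))).1 ^ (d i - (r + 1) - 1) *
          p k.succ ^ ((r : ℕ) + 1), fun K _ _ μ x hμ => ?_⟩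
        rw [key K μ x hμ]
        have hps : p k.castSucc = MvPolynomial.X (σ (Sum.inl (k, q))).1 := by
          rw [hk]
          simp [p]
        have hpow : d i - (r + 1) = d i - (r + 1) - 1 + 1 := by omega
        rw [hps]
        simp only [map_mul, map_pow, MvPolynomial.aeval_X]
        rw [hpow]
        simp only [Nat.add_sub_cancel]
        ring
    · refine ⟨MvPolynomial.X a ^ (d i - 1), fun K _ _ μ x hμ => ?_⟩
      have hpow : d i = d i - 1 + 1 := by have := hd i; omega
      simp only [f, Sum.elim_inr, MvPolynomial.aeval_rename, hσr, map_pow, MvPolynomial.aeval_X]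
      rw [← pow_succ', ← hpow]
      exact (hG i).aeval_const_mul (μ a) fun s => x (a, s))
  refine ⟨chainOf v w fun a s => z (a, s), chainOf_zero .., chainOf_last .., ?_, ?_⟩
  · refine forall_chainOf (by simpa using hv) (by simpa using hw) fun a h => ?_
    obtain ⟨i, hi⟩ := hz0 a
    rw [chainOf_castSucc_succ] at h
    exact hi (congrFun h i)
  · intro i k a b
    have hGz : ∀ k, MvPolynomial.eval (chainOf v w (fun a s => z (a, s)) k) (G i) = 0 := by
      refine forall_chainOf (by simpa using hGv i) (by simpa using hGw i) fun a => ?_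
      have := hz (Sum.inr (a, i))
      simp only [f, Sum.elim_inr, MvPolynomial.aeval_rename, MvPolynomial.aeval_eq_eval] at this
      rw [chainOf_castSucc_succ]
      exact this
    have hPz : ∀ k, (fun s => MvPolynomial.aeval z (P k s)) =
        chainOf v w (fun a s => z (a, s)) k := by
      refine forall_chainOf ?_ ?_ fun a => ?_ <;> funext s <;> simp [P]
    refine aeval_line_eq_zero (hG i) _ _ (hGz _) (hGz _) (fun j hj hjd => ?_) a b
    have := hz (Sum.inl (k, finSigmaFinEquiv ⟨i, ⟨j - 1, by omega⟩⟩))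
    simp only [f, Sum.elim_inl] at this
    rw [Equiv.symm_apply_apply, aeval_coeff, hPz, hPz, Nat.sub_add_cancel hj] at this
    exact this
end
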